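/- arXiv:2209.03402 — 6 statements merged into one kernel-verified Lean document; each statement's English description precedes it below -/
import Mathlib

section
/- Let H and G be graphs, let c be a surjective homomorphism from G to H, and let r ∈ ℕ₀. Then the map sending ψ to its restriction ψ|_{V(H)} is a bijection from the set of homomorphisms ψ from H^r to G^r with c^r ∘ ψ = id_{V(H^r)} onto the set of homomorphisms φ from H to G with c ∘ φ = id_{V(H)}. In particular, the number of homomorphisms φ from H to G with c ∘ φ = id_{V(H)} equals the number of homomorphisms ψ from H^r to G^r with c^r ∘ ψ = id_{V(H^r)}. -/
open SimpleGraph Function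

namespace Fmz

variable {V : Type*} {W : Type*} {V₁ : Type*} {V₂ : Type*} {VH : Type*}


/-- Carrier of internal (subdivision) vertices when each edge `e` of `G` is replaced by a
path of length `ℓ e`: a dart `d` together with an index `i` with `i + 1 < ℓ (d.edge)`,
representing the `i`-th internal vertex counted from the tail of `d`. -/
def StretchCarrier (G : SimpleGraph V) (ℓ : Sym2 V → ℕ) : Type _ :=
  {p : G.Dart × ℕ // p.2 + 1 < ℓ p.1.edge}

/-- The identification `(d, i) ↦ (d.symm, ℓ(d.edge) - 2 - i)`. -/
def flipC (G : SimpleGraph V) (ℓ : Sym2 V → ℕ) (p : StretchCarrier G ℓ) : StretchCarrier G ℓ :=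
  ⟨(p.1.1.symm, ℓ p.1.1.edge - 2 - p.1.2), by
    have hp := p.2
    show ℓ p.1.1.edge - 2 - p.1.2 + 1 < ℓ p.1.1.symm.edge
    rw [SimpleGraph.Dart.edge_symm]
    omega⟩

lemma flipC_flipC (G : SimpleGraph V) (ℓ : Sym2 V → ℕ) (p : StretchCarrier G ℓ) :
    flipC G ℓ (flipC G ℓ p) = p := by
  obtain ⟨⟨d, i⟩, hp⟩ := p
  have hp' : i + 1 < ℓ d.edge := hp
  apply Subtype.ext
  show (d.symm.symm, ℓ d.symm.edge - 2 - (ℓ d.edge - 2 - i)) = (d, i)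
  rw [SimpleGraph.Dart.symm_symm, SimpleGraph.Dart.edge_symm, Prod.mk.injEq]
  exact ⟨rfl, by omega⟩

/-- Internal vertices of the stretched graph: each edge contributes its internal path
vertices exactly once (the two darts of an edge are identified in reversed order). -/
def StretchSetoid (G : SimpleGraph V) (ℓ : Sym2 V → ℕ) : Setoid (StretchCarrier G ℓ) where
  r p q := q = p ∨ q = flipC G ℓ p
  iseqv := by
    refine ⟨fun _ => Or.inl rfl, ?_, ?_⟩
    · rintro p q (rfl | rfl)
      · exact Or.inl rfl
      · exact Or.inr (flipC_flipC G ℓ p).symm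
    · rintro p q t (rfl | rfl) (rfl | rfl)
      · exact Or.inl rfl
      · exact Or.inr rfl
      · exact Or.inr rfl
      · exact Or.inl (flipC_flipC G ℓ p)

/-- Vertices of the stretched graph: original (branch) vertices plus internal vertices. -/
def StretchVert (G : SimpleGraph V) (ℓ : Sym2 V → ℕ) : Type _ :=
  V ⊕ Quotient (StretchSetoid G ℓ)

/-- Base relation for the stretched graph. -/
def stretchBase (G : SimpleGraph V) (ℓ : Sym2 V → ℕ) :
    StretchVert G ℓ → StretchVert G ℓ → Prop
  | Sum.inl u, Sum.inl v => G.Adj u v ∧ ℓ s(u, v) = 1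
  | Sum.inl u, Sum.inr q => ∃ (d : G.Dart) (h : 1 < ℓ d.edge),
      d.toProd.1 = u ∧ q = Quotient.mk (StretchSetoid G ℓ) ⟨(d, 0), h⟩
  | Sum.inr _, Sum.inl _ => False
  | Sum.inr q, Sum.inr q' => ∃ (d : G.Dart) (i : ℕ) (h : i + 2 < ℓ d.edge),
      q = Quotient.mk (StretchSetoid G ℓ) ⟨(d, i), show i + 1 < ℓ d.edge by omega⟩ ∧
      q' = Quotient.mk (StretchSetoid G ℓ) ⟨(d, i + 1), show i + 1 + 1 < ℓ d.edge by omega⟩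

/-- The graph obtained from `G` by replacing each edge `e` by a path of length `ℓ e`
(with `ℓ e - 1` fresh internal vertices), the replacing paths being internally disjoint. -/
def Stretch (G : SimpleGraph V) (ℓ : Sym2 V → ℕ) : SimpleGraph (StretchVert G ℓ) :=
  SimpleGraph.fromRel (stretchBase G ℓ)

/-- The `r`-subdivision `G^r` of `G`: every edge is replaced by a path of `r + 1` edges
(`r` internal vertices). -/
abbrev Subdiv (G : SimpleGraph V) (r : ℕ) : SimpleGraph (StretchVert G (fun _ => r + 1)) :=
  Stretch G (fun _ => r + 1)

lemma mapDart_symm {G : SimpleGraph V} {H : SimpleGraph W} (c : G →g H) (d : G.Dart) :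
    c.mapDart d.symm = (c.mapDart d).symm :=
  SimpleGraph.Dart.ext _ _ rfl

lemma mapDart_edge {G : SimpleGraph V} {H : SimpleGraph W} (c : G →g H) (d : G.Dart) :
    (c.mapDart d).edge = Sym2.map c d.edge :=
  rfl

/-- Map on internal vertices induced by a homomorphism `c : G →g H`, where the edge
lengths on `G` are pulled back from the edge lengths `ℓ` on `H` along `c`. -/
def stretchCarrierMap {G : SimpleGraph V} {H : SimpleGraph W} (c : G →g H) (ℓ : Sym2 W → ℕ)
    (p : StretchCarrier G (fun e => ℓ (Sym2.map c e))) : StretchCarrier H ℓ :=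
  ⟨(c.mapDart p.1.1, p.1.2), by
    have hp := p.2
    show p.1.2 + 1 < ℓ ((c.mapDart p.1.1).edge)
    rw [mapDart_edge]
    exact hp⟩

lemma stretchCarrierMap_flip {G : SimpleGraph V} {H : SimpleGraph W} (c : G →g H)
    (ℓ : Sym2 W → ℕ) (p : StretchCarrier G (fun e => ℓ (Sym2.map c e))) :
    stretchCarrierMap c ℓ (flipC G _ p) = flipC H ℓ (stretchCarrierMap c ℓ p) := by
  apply Subtype.ext
  show (c.mapDart p.1.1.symm, ℓ (Sym2.map c p.1.1.edge) - 2 - p.1.2)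
      = ((c.mapDart p.1.1).symm, ℓ ((c.mapDart p.1.1).edge) - 2 - p.1.2)
  rw [mapDart_symm, mapDart_edge]

/-- The canonical colouring `c^ℓ` on the stretched graphs induced by a homomorphism
`c : G →g H`: it agrees with `c` on branch vertices and maps the `i`-th internal vertex
(counted from `u`) of the path replacing an edge `{u,v}` of `G` to the `i`-th internal
vertex (counted from `c u`) of the path replacing `{c u, c v}` in the stretch of `H`. -/
def stretchMapFun {G : SimpleGraph V} {H : SimpleGraph W} (c : G →g H) (ℓ : Sym2 W → ℕ) :
    StretchVert G (fun e => ℓ (Sym2.map c e)) → StretchVert H ℓ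
  | Sum.inl u => Sum.inl (c u)
  | Sum.inr q => Sum.inr (Quotient.lift
      (fun p => Quotient.mk (StretchSetoid H ℓ) (stretchCarrierMap c ℓ p))
      (by
        rintro a b (rfl | rfl)
        · rfl
        · show Quotient.mk (StretchSetoid H ℓ) (stretchCarrierMap c ℓ a)
              = Quotient.mk (StretchSetoid H ℓ) (stretchCarrierMap c ℓ (flipC G _ a))
          rw [stretchCarrierMap_flip]
          exact Quotient.sound (Or.inr rfl)) q)

/-- The canonical colouring `c^r` of `G^r` induced by a (surjective) homomorphism
`c : G →g H`. -/
def subdivMapFun {G : SimpleGraph V} {H : SimpleGraph W} (c : G →g H) (r : ℕ) :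
    StretchVert G (fun _ => r + 1) → StretchVert H (fun _ => r + 1) :=
  stretchMapFun c (fun _ => r + 1)


/-- The `i`-th internal vertex, counted from the tail of `d`, of the path replacing the edge
of `d` in the `r`-subdivision of `G`. -/
def inner (G : SimpleGraph V) (r : ℕ) (d : G.Dart) (i : ℕ) (h : i < r) :
    StretchVert G (fun _ => r + 1) :=
  Sum.inr (Quotient.mk (StretchSetoid G (fun _ => r + 1)) ⟨(d, i), Nat.succ_lt_succ h⟩)

lemma inner_eq_inner_iff {G : SimpleGraph V} {r : ℕ} {d e : G.Dart} {i j : ℕ}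
    {hi : i < r} {hj : j < r} :
    inner G r d i hi = inner G r e j hj ↔ (e = d ∧ j = i) ∨ (e = d.symm ∧ i + j + 1 = r) := by
  have key : inner G r d i hi = inner G r e j hj ↔
      (e, j) = (d, i) ∨ (e, j) = (d.symm, r + 1 - 2 - i) := by
    refine Sum.inr_injective.eq_iff.trans (Quotient.eq.trans ?_)
    exact or_congr Subtype.ext_iff Subtype.ext_iff
  rw [key, Prod.mk.injEq, Prod.mk.injEq]
  refine or_congr Iff.rfl (and_congr_right fun _ => ?_)
  omega

lemma inner_symm {G : SimpleGraph V} {r : ℕ} (d : G.Dart) {i j : ℕ} (hi : i < r) (hj : j < r)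
    (h : i + j + 1 = r) : inner G r d.symm j hj = inner G r d i hi :=
  (inner_eq_inner_iff.2 (Or.inr ⟨rfl, h⟩)).symm

lemma exists_eq_inl_or_inner {G : SimpleGraph V} {r : ℕ} (x : StretchVert G (fun _ => r + 1)) :
    (∃ v, x = Sum.inl v) ∨ ∃ d i h, x = inner G r d i h := by
  rcases x with v | q
  · exact Or.inl ⟨v, rfl⟩
  · induction q using Quotient.inductionOn with
    | h p => exact Or.inr ⟨p.1.1, p.1.2, Nat.lt_of_succ_lt_succ p.2, rfl⟩

lemma subdiv_adj_inl_inl {G : SimpleGraph V} {r : ℕ} {u v : V} :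
    (Subdiv G r).Adj (Sum.inl u) (Sum.inl v) ↔ G.Adj u v ∧ r = 0 := by
  have key : (Subdiv G r).Adj (Sum.inl u) (Sum.inl v) ↔
      (Sum.inl u : StretchVert G (fun _ => r + 1)) ≠ Sum.inl v ∧
        ((G.Adj u v ∧ r + 1 = 1) ∨ (G.Adj v u ∧ r + 1 = 1)) := Iff.rfl
  rw [key, G.adj_comm v u, or_self, Nat.add_eq_right]
  exact and_iff_right_of_imp fun h e => h.1.ne (Sum.inl.inj e)

lemma subdiv_adj_inl_inner {G : SimpleGraph V} {r : ℕ} {u : V} {d : G.Dart} {i : ℕ}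
    {h : i < r} :
    (Subdiv G r).Adj (Sum.inl u) (inner G r d i h) ↔
      (u = d.fst ∧ i = 0) ∨ (u = d.snd ∧ i + 1 = r) := by
  have key : (Subdiv G r).Adj (Sum.inl u) (inner G r d i h) ↔
      ∃ (e : G.Dart) (h' : 0 < r), e.fst = u ∧ inner G r d i h = inner G r e 0 h' := by
    constructor
    · rintro ⟨-, ⟨e, h', he, hq⟩ | h⟩
      · exact ⟨e, Nat.lt_of_succ_lt_succ h', he, congrArg Sum.inr hq⟩
      · exact h.elim
    · rintro ⟨e, h', he, hq⟩
      exact ⟨Sum.inl_ne_inr, Or.inl ⟨e, Nat.succ_lt_succ h', he, Sum.inr.inj hq⟩⟩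
  simp only [key, inner_eq_inner_iff]
  constructor
  · rintro ⟨e, -, rfl, ⟨rfl, hi⟩ | ⟨rfl, hi⟩⟩
    · exact Or.inl ⟨rfl, hi.symm⟩
    · exact Or.inr ⟨rfl, hi⟩
  · rintro (⟨rfl, hi⟩ | ⟨rfl, hi⟩)
    · exact ⟨d, by omega, rfl, Or.inl ⟨rfl, hi.symm⟩⟩
    · exact ⟨d.symm, by omega, rfl, Or.inr ⟨rfl, hi⟩⟩

lemma subdiv_adj_inner_inner {G : SimpleGraph V} {r : ℕ} {d e : G.Dart} {i j : ℕ}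
    {hi : i < r} {hj : j < r} :
    (Subdiv G r).Adj (inner G r d i hi) (inner G r e j hj) ↔
      (e = d ∧ (i + 1 = j ∨ j + 1 = i)) ∨ (e = d.symm ∧ (i + j + 2 = r ∨ i + j = r)) := by
  have base : ∀ {d e : G.Dart} {i j : ℕ} {hi : i < r} {hj : j < r},
      stretchBase G (fun _ => r + 1) (inner G r d i hi) (inner G r e j hj) ↔
        ∃ (f : G.Dart) (k : ℕ) (h : k + 1 < r),
          inner G r d i hi = inner G r f k (Nat.lt_of_succ_lt h) ∧
          inner G r e j hj = inner G r f (k + 1) h := by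
    intro d e i j hi hj
    constructor
    · rintro ⟨f, k, h, h₁, h₂⟩
      exact ⟨f, k, Nat.lt_of_succ_lt_succ h, congrArg Sum.inr h₁, congrArg Sum.inr h₂⟩
    · rintro ⟨f, k, h, h₁, h₂⟩
      exact ⟨f, k, Nat.succ_lt_succ h, Sum.inr.inj h₁, Sum.inr.inj h₂⟩
  constructor
  · rintro ⟨-, h | h⟩
    all_goals
      obtain ⟨f, k, hk, h₁, h₂⟩ := base.1 h
      rw [inner_eq_inner_iff] at h₁ h₂
      obtain ⟨rfl, h₁⟩ | ⟨rfl, h₁⟩ := h₁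
    · obtain ⟨rfl, h₂⟩ | ⟨h₃, h₂⟩ := h₂
      · exact Or.inl ⟨rfl, by omega⟩
      · exact Or.inr ⟨by rw [h₃, Dart.symm_symm], by omega⟩
    · obtain ⟨rfl, h₂⟩ | ⟨h₃, h₂⟩ := h₂
      · exact Or.inr ⟨rfl, by omega⟩
      · exact Or.inl ⟨Dart.symm_involutive.injective h₃.symm, by omega⟩
    · obtain ⟨rfl, h₂⟩ | ⟨rfl, h₂⟩ := h₂
      · exact Or.inl ⟨rfl, by omega⟩
      · exact Or.inr ⟨rfl, by omega⟩
    · obtain ⟨rfl, h₂⟩ | ⟨h₃, h₂⟩ := h₂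
      · exact Or.inr ⟨by rw [Dart.symm_symm], by omega⟩
      · exact Or.inl ⟨Dart.symm_involutive.injective h₃, by omega⟩
  · intro h
    refine ⟨fun heq => ?_, ?_⟩
    · rw [inner_eq_inner_iff] at heq
      obtain ⟨rfl, h⟩ | ⟨rfl, h⟩ := h <;> obtain ⟨hd, h'⟩ | ⟨hd, h'⟩ := heq
      · omega
      · exact e.symm_ne hd.symm
      · exact d.symm_ne hd
      · omega
    · obtain ⟨rfl, rfl | rfl⟩ | ⟨rfl, h | h⟩ := h
      · exact Or.inl (base.2 ⟨e, i, hj, rfl, rfl⟩)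
      · exact Or.inr (base.2 ⟨e, j, hi, rfl, rfl⟩)
      · exact Or.inl (base.2 ⟨d, i, by omega, rfl, inner_symm d _ hj (by omega)⟩)
      · exact Or.inr (base.2 ⟨d, i - 1, by omega, inner_symm d _ hj (by omega),
          inner_eq_inner_iff.2 (Or.inl ⟨rfl, by omega⟩)⟩)

@[simp]
lemma subdivMapFun_inl {G : SimpleGraph V} {H : SimpleGraph W} (c : G →g H) (r : ℕ) (v : V) :
    subdivMapFun c r (Sum.inl v) = Sum.inl (c v) :=
  rfl

@[simp]
lemma subdivMapFun_inner {G : SimpleGraph V} {H : SimpleGraph W} (c : G →g H) {r : ℕ}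
    (d : G.Dart) (i : ℕ) (h : i < r) :
    subdivMapFun c r (inner G r d i h) = inner H r (c.mapDart d) i h :=
  rfl

/-- The canonical colouring `c^r`, as a graph homomorphism. -/
def subdivMap {G : SimpleGraph V} {H : SimpleGraph W} (c : G →g H) (r : ℕ) :
    Subdiv G r →g Subdiv H r where
  toFun := subdivMapFun c r
  map_rel' := by
    have inl_inner : ∀ (u : V) (d : G.Dart) (i : ℕ) (h : i < r),
        (Subdiv G r).Adj (Sum.inl u) (inner G r d i h) →
        (Subdiv H r).Adj (Sum.inl (c u)) (inner H r (c.mapDart d) i h) := by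
      intro u d i h
      rw [subdiv_adj_inl_inner, subdiv_adj_inl_inner]
      rintro (⟨rfl, hi⟩ | ⟨rfl, hi⟩)
      · exact Or.inl ⟨rfl, hi⟩
      · exact Or.inr ⟨rfl, hi⟩
    intro x y hxy
    obtain ⟨u, rfl⟩ | ⟨d, i, hi, rfl⟩ := exists_eq_inl_or_inner x <;>
      obtain ⟨v, rfl⟩ | ⟨e, j, hj, rfl⟩ := exists_eq_inl_or_inner y
    · rw [subdiv_adj_inl_inl] at hxy
      exact subdiv_adj_inl_inl.2 ⟨c.map_adj hxy.1, hxy.2⟩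
    · exact inl_inner u e j hj hxy
    · exact (inl_inner v d i hi hxy.symm).symm
    · rw [subdiv_adj_inner_inner] at hxy
      refine (subdiv_adj_inner_inner (hi := hi) (hj := hj)).2 ?_
      obtain ⟨rfl, h⟩ | ⟨rfl, h⟩ := hxy
      · exact Or.inl ⟨rfl, h⟩
      · exact Or.inr ⟨mapDart_symm c d, h⟩

section RightInverse

variable {G : SimpleGraph V} {H : SimpleGraph W} {c : G →g H} {r : ℕ}

lemma subdivMapFun_comp_subdivMap {φ : H →g G} (hφ : ⇑c ∘ ⇑φ = id) :
    subdivMapFun c r ∘ ⇑(subdivMap φ r) = id := by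
  funext x
  obtain ⟨u, rfl⟩ | ⟨d, i, hi, rfl⟩ := exists_eq_inl_or_inner x
  · exact congrArg Sum.inl (congrFun hφ u)
  · have hd : c.mapDart (φ.mapDart d) = d :=
      SimpleGraph.Dart.ext _ _ (Prod.ext (congrFun hφ d.fst) (congrFun hφ d.snd))
    change inner H r (c.mapDart (φ.mapDart d)) i hi = inner H r d i hi
    rw [hd]

lemma exists_eq_inl_of_subdivMapFun_eq_inl {x : StretchVert G (fun _ => r + 1)} {w : W}
    (h : subdivMapFun c r x = Sum.inl w) : ∃ v, x = Sum.inl v ∧ c v = w := by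
  obtain ⟨u, rfl⟩ | ⟨d, i, hi, rfl⟩ := exists_eq_inl_or_inner x
  · exact ⟨u, rfl, Sum.inl.inj h⟩
  · exact (Sum.inr_ne_inl h).elim

lemma exists_eq_inner_of_subdivMapFun_eq_inner {x : StretchVert G (fun _ => r + 1)}
    {d : H.Dart} {i : ℕ} {hi : i < r} (h : subdivMapFun c r x = inner H r d i hi) :
    ∃ e : G.Dart, x = inner G r e i hi ∧ c.mapDart e = d := by
  obtain ⟨u, rfl⟩ | ⟨e, j, hj, rfl⟩ := exists_eq_inl_or_inner x
  · exact (Sum.inl_ne_inr h).elim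
  · rw [subdivMapFun_inner, inner_eq_inner_iff] at h
    obtain ⟨rfl, rfl⟩ | ⟨rfl, h⟩ := h
    · exact ⟨e, rfl, rfl⟩
    · exact ⟨e.symm, (inner_symm e hj hi h).symm, mapDart_symm c e⟩

/-- A right inverse of `c^r` maps the path replacing the edge of `d` into the path replacing
a single edge of `G`. -/
lemma exists_dart_forall_le {ψ : Subdiv H r →g Subdiv G r}
    (hψ : ∀ x, subdivMapFun c r (ψ x) = x) {f : W → V} (hf : ∀ w, ψ (Sum.inl w) = Sum.inl (f w))
    (d : H.Dart) (n : ℕ) (hn : n < r) :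
    ∃ e : G.Dart, c.mapDart e = d ∧ e.fst = f d.fst ∧
      ∀ i (hi : i ≤ n), ψ (inner H r d i (hi.trans_lt hn)) = inner G r e i (hi.trans_lt hn) := by
  have hcf : ∀ w, c (f w) = w := fun w => by
    have h := hψ (Sum.inl w)
    rw [hf] at h
    exact Sum.inl.inj h
  induction n with
  | zero =>
    obtain ⟨e, he, rfl⟩ := exists_eq_inner_of_subdivMapFun_eq_inner (hψ (inner H r d 0 hn))
    have hadj : (Subdiv G r).Adj (ψ (Sum.inl (c.mapDart e).fst)) (ψ (inner H r _ 0 hn)) :=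
      ψ.map_adj (subdiv_adj_inl_inner.2 (Or.inl ⟨rfl, rfl⟩))
    rw [he, hf, subdiv_adj_inl_inner] at hadj
    refine ⟨e, rfl, ?_, fun i hi => ?_⟩
    · obtain h | h := hadj
      · exact h.1.symm
      · have h' := hcf (c.mapDart e).fst
        rw [h.1] at h'
        exact ((c.mapDart e).fst_ne_snd h'.symm).elim
    · obtain rfl : i = 0 := by omega
      exact he
  | succ n ih =>
    obtain ⟨e, rfl, he, ih⟩ := ih (Nat.lt_of_succ_lt hn)
    obtain ⟨e', he', hce⟩ :=
      exists_eq_inner_of_subdivMapFun_eq_inner (hψ (inner H r (c.mapDart e) (n + 1) hn))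
    have hadj : (Subdiv G r).Adj (ψ (inner H r (c.mapDart e) n (Nat.lt_of_succ_lt hn)))
        (ψ (inner H r (c.mapDart e) (n + 1) hn)) :=
      ψ.map_adj (subdiv_adj_inner_inner.2 (Or.inl ⟨rfl, Or.inl rfl⟩))
    rw [he', ih n le_rfl, subdiv_adj_inner_inner] at hadj
    refine ⟨e, rfl, he, fun i hi => ?_⟩
    obtain h | rfl := Nat.le_or_eq_of_le_succ hi
    · exact ih i h
    · obtain ⟨rfl, -⟩ | ⟨rfl, -⟩ := hadj
      · exact he'
      · rw [mapDart_symm] at hce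
        exact ((c.mapDart e).symm_ne hce).elim

/-- A right inverse of `c^r` restricts to a homomorphism on branch vertices, and is induced
by this restriction. -/
lemma exists_hom_eq_subdivMap {ψ : Subdiv H r →g Subdiv G r}
    (hψ : subdivMapFun c r ∘ ⇑ψ = id) :
    ∃ φ : H →g G, ⇑c ∘ ⇑φ = id ∧ ψ = subdivMap φ r := by
  have hψ' : ∀ x, subdivMapFun c r (ψ x) = x := congrFun hψ
  choose f hf hcf using fun w => exists_eq_inl_of_subdivMapFun_eq_inl (hψ' (Sum.inl w))
  have key : ∀ d : H.Dart, ∃ e : G.Dart, e.fst = f d.fst ∧ e.snd = f d.snd ∧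
      ∀ i (hi : i < r), ψ (inner H r d i hi) = inner G r e i hi := by
    intro d
    rcases Nat.eq_zero_or_pos r with rfl | hr
    · have hadj := ψ.map_adj (subdiv_adj_inl_inl.2 ⟨d.adj, rfl⟩)
      rw [hf, hf, subdiv_adj_inl_inl] at hadj
      exact ⟨⟨(f d.fst, f d.snd), hadj.1⟩, rfl, rfl, fun i hi => (Nat.not_lt_zero i hi).elim⟩
    · have hr' : r - 1 < r := by omega
      obtain ⟨e, hce, he, hi⟩ := exists_dart_forall_le hψ' hf d (r - 1) hr'
      obtain ⟨e', hce', he', hi'⟩ := exists_dart_forall_le hψ' hf d.symm (r - 1) hr'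
      refine ⟨e, he, ?_, fun i h => hi i (by omega)⟩
      have h := hi' 0 (Nat.zero_le _)
      rw [inner_symm d hr' hr (by omega), hi _ le_rfl, inner_eq_inner_iff] at h
      obtain ⟨rfl, -⟩ | ⟨rfl, -⟩ := h
      · exact (d.symm_ne (hce'.symm.trans hce)).elim
      · exact he'
  let φ : H →g G := ⟨f, fun {u v} h => by
    obtain ⟨e, he₁, he₂, -⟩ := key ⟨(u, v), h⟩
    exact he₁ ▸ he₂ ▸ e.adj⟩
  refine ⟨φ, funext hcf, RelHom.ext fun x => ?_⟩
  obtain ⟨u, rfl⟩ | ⟨d, i, hi, rfl⟩ := exists_eq_inl_or_inner x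
  · exact hf u
  · obtain ⟨e, he₁, he₂, he⟩ := key d
    obtain rfl : e = φ.mapDart d := SimpleGraph.Dart.ext _ _ (Prod.ext he₁ he₂)
    exact he i hi

end RightInverse

/-- For a surjective homomorphism `c : G →g H` and `r ∈ ℕ`, restriction
to branch vertices is a bijection from the homomorphisms `ψ : H^r →g G^r` with
`c^r ∘ ψ = id` onto the homomorphisms `φ : H →g G` with `c ∘ φ = id`; in particular the
two sets have the same cardinality. -/
theorem stmt_0 {V W : Type} [Fintype V] [Fintype W]
    (G : SimpleGraph V) (H : SimpleGraph W) (c : G →g H) (hc : Function.Surjective ⇑c)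
    (r : ℕ) :
    (∃ F : {ψ : Subdiv H r →g Subdiv G r // subdivMapFun c r ∘ ⇑ψ = id} →
        {φ : H →g G // ⇑c ∘ ⇑φ = id},
      (∀ (ψ : {ψ : Subdiv H r →g Subdiv G r // subdivMapFun c r ∘ ⇑ψ = id}) (v : W),
        (Sum.inl ((F ψ).1 v) : StretchVert G (fun _ => r + 1)) = ψ.1 (Sum.inl v)) ∧
      Function.Bijective F) ∧
    Nat.card {φ : H →g G // ⇑c ∘ ⇑φ = id}
      = Nat.card {ψ : Subdiv H r →g Subdiv G r // subdivMapFun c r ∘ ⇑ψ = id} := by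
  choose F hF hψ using
    fun ψ : {ψ : Subdiv H r →g Subdiv G r // subdivMapFun c r ∘ ⇑ψ = id} =>
      exists_hom_eq_subdivMap ψ.2
  have hinl : ∀ (ψ : {ψ : Subdiv H r →g Subdiv G r // subdivMapFun c r ∘ ⇑ψ = id}) (v : W),
      (Sum.inl (F ψ v) : StretchVert G (fun _ => r + 1)) = ψ.1 (Sum.inl v) := fun ψ v =>
    (DFunLike.congr_fun (hψ ψ) (Sum.inl v)).symm
  have hbij : Function.Bijective fun ψ => (⟨F ψ, hF ψ⟩ : {φ : H →g G // ⇑c ∘ ⇑φ = id}) := by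
    refine ⟨fun ψ₁ ψ₂ h => Subtype.ext ?_, fun φ => ?_⟩
    · rw [hψ ψ₁, hψ ψ₂, Subtype.mk.inj h]
    · refine ⟨⟨subdivMap φ.1 r, subdivMapFun_comp_subdivMap φ.2⟩, Subtype.ext ?_⟩
      exact RelHom.ext fun v => Sum.inl.inj (hinl _ v)
  exact ⟨⟨_, hinl, hbij⟩, (Nat.card_eq_of_bijective _ hbij).symm⟩

end Fmz
end

section
/- Let H and G be graphs, let c be a surjective homomorphism from G to H, and let ℓ : E(H) → ℕ assign a positive length to each edge of H. Let H' be obtained from H by replacing each edge e by a path of length ℓ(e), let G' be obtained from G by replacing each edge f = {u,v} by a path of length ℓ({c(u),c(v)}), and let c' be the homomorphism from G' to H' that agrees with c on V(G) and, for each edge f = {u,v} of G, maps the i-th internal vertex (counted from u) of the path replacing f to the i-th internal vertex (counted from c(u)) of the path replacing {c(u),c(v)}. Then the number of homomorphisms φ from H to G with c ∘ φ = id_{V(H)} equals the number of homomorphisms φ' from H' to G' with c' ∘ φ' = id_{V(H')}. -/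
open SimpleGraph Function

namespace Fmz

variable {V : Type*} {W : Type*} {V₁ : Type*} {V₂ : Type*} {VH : Type*}


/-- The `i`-th internal vertex, counted from the tail of `d`, of the path replacing `d.edge`. -/
def internalVert (G : SimpleGraph V) (ℓ : Sym2 V → ℕ) (d : G.Dart) (i : ℕ)
    (h : i + 1 < ℓ d.edge) : StretchVert G ℓ :=
  Sum.inr (Quotient.mk (StretchSetoid G ℓ) ⟨(d, i), h⟩)

/-- The branch vertex of the stretched graph corresponding to `u`. -/
def branchVert (G : SimpleGraph V) (ℓ : Sym2 V → ℕ) (u : V) : StretchVert G ℓ :=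
  Sum.inl u

lemma branchVert_injective (G : SimpleGraph V) (ℓ : Sym2 V → ℕ) :
    Injective (branchVert G ℓ) :=
  fun _ _ h => Sum.inl.inj h

lemma stretchVert_cases {G : SimpleGraph V} {ℓ : Sym2 V → ℕ} (x : StretchVert G ℓ) :
    (∃ u, x = branchVert G ℓ u) ∨ ∃ d i h, x = internalVert G ℓ d i h := by
  rcases x with u | q
  · exact Or.inl ⟨u, rfl⟩
  · induction q using Quotient.ind with
    | _ p => exact Or.inr ⟨p.1.1, p.1.2, p.2, rfl⟩

lemma mk_eq_mk_iff {G : SimpleGraph V} {ℓ : Sym2 V → ℕ} {d e : G.Dart} {i j : ℕ}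
    {h : i + 1 < ℓ d.edge} {k : j + 1 < ℓ e.edge} :
    Quotient.mk (StretchSetoid G ℓ) ⟨(d, i), h⟩ = Quotient.mk (StretchSetoid G ℓ) ⟨(e, j), k⟩ ↔
      (e = d ∧ j = i) ∨ (e = d.symm ∧ j = ℓ d.edge - 2 - i) := by
  refine Quotient.eq.trans (or_congr ?_ ?_)
  · exact Subtype.ext_iff.trans Prod.ext_iff
  · exact Subtype.ext_iff.trans Prod.ext_iff

lemma internalVert_eq_iff {G : SimpleGraph V} {ℓ : Sym2 V → ℕ} {d e : G.Dart} {i j : ℕ}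
    {h : i + 1 < ℓ d.edge} {k : j + 1 < ℓ e.edge} :
    internalVert G ℓ d i h = internalVert G ℓ e j k ↔
      (e = d ∧ j = i) ∨ (e = d.symm ∧ j = ℓ d.edge - 2 - i) :=
  Sum.inr_injective.eq_iff.trans mk_eq_mk_iff

lemma internalVert_symm {G : SimpleGraph V} {ℓ : Sym2 V → ℕ} (d : G.Dart)
    (h : 1 < ℓ d.edge) :
    internalVert G ℓ d (ℓ d.edge - 2) (by omega) =
      internalVert G ℓ d.symm 0 (by rwa [SimpleGraph.Dart.edge_symm]) :=
  internalVert_eq_iff.2 (Or.inr ⟨rfl, by omega⟩)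

lemma stretch_adj {G : SimpleGraph V} {ℓ : Sym2 V → ℕ} {x y : StretchVert G ℓ} :
    (Stretch G ℓ).Adj x y ↔ x ≠ y ∧ (stretchBase G ℓ x y ∨ stretchBase G ℓ y x) :=
  SimpleGraph.fromRel_adj _ _ _

lemma stretch_adj_branchVert {G : SimpleGraph V} {ℓ : Sym2 V → ℕ} {u v : V} :
    (Stretch G ℓ).Adj (branchVert G ℓ u) (branchVert G ℓ v) ↔ G.Adj u v ∧ ℓ s(u, v) = 1 := by
  rw [stretch_adj]
  change _ ∧ (G.Adj u v ∧ ℓ s(u, v) = 1 ∨ G.Adj v u ∧ ℓ s(v, u) = 1) ↔ _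
  rw [Sym2.eq_swap (a := v), G.adj_comm v u, or_self]
  exact and_iff_right_of_imp fun h e => h.1.ne (branchVert_injective G ℓ e)

lemma stretch_adj_branchVert_internalVert {G : SimpleGraph V} {ℓ : Sym2 V → ℕ} (d : G.Dart)
    (h : 1 < ℓ d.edge) :
    (Stretch G ℓ).Adj (branchVert G ℓ d.fst) (internalVert G ℓ d 0 h) :=
  stretch_adj.2 ⟨Sum.inl_ne_inr, Or.inl ⟨d, h, rfl, rfl⟩⟩

lemma stretch_adj_internalVert_succ {G : SimpleGraph V} {ℓ : Sym2 V → ℕ} (d : G.Dart) (i : ℕ)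
    (h : i + 2 < ℓ d.edge) :
    (Stretch G ℓ).Adj (internalVert G ℓ d i (by omega)) (internalVert G ℓ d (i + 1) h) := by
  refine stretch_adj.2 ⟨fun e => ?_, Or.inl ⟨d, i, h, rfl, rfl⟩⟩
  rcases internalVert_eq_iff.1 e with ⟨_, e⟩ | ⟨e, _⟩
  · omega
  · exact d.symm_ne e.symm

section Map

variable {G : SimpleGraph V} {H : SimpleGraph W} (c : G →g H) {ℓ : Sym2 W → ℕ}

lemma stretchMapFun_branchVert (u : V) :
    stretchMapFun c ℓ (branchVert G _ u) = branchVert H ℓ (c u) :=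
  rfl

lemma stretchMapFun_internalVert (d : G.Dart) (i : ℕ)
    (h : i + 1 < ℓ (Sym2.map c d.edge)) :
    stretchMapFun c ℓ (internalVert G _ d i h) =
      internalVert H ℓ (c.mapDart d) i (by rwa [mapDart_edge]) :=
  rfl

lemma exists_branchVert_of_stretchMapFun_eq {x : StretchVert G (fun e => ℓ (Sym2.map c e))}
    {w : W} (h : stretchMapFun c ℓ x = branchVert H ℓ w) :
    ∃ v, x = branchVert G _ v ∧ c v = w := by
  rcases stretchVert_cases x with ⟨u, rfl⟩ | ⟨d, i, k, rfl⟩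
  · exact ⟨u, rfl, branchVert_injective H ℓ h⟩
  · exact absurd h Sum.inr_ne_inl

lemma exists_internalVert_of_stretchMapFun_eq
    {x : StretchVert G (fun e => ℓ (Sym2.map c e))} {d : H.Dart} {i : ℕ}
    {k : i + 1 < ℓ d.edge} (h : stretchMapFun c ℓ x = internalVert H ℓ d i k) :
    ∃ (e : G.Dart) (k' : i + 1 < ℓ (Sym2.map c e.edge)),
      x = internalVert G (fun e => ℓ (Sym2.map c e)) e i k' ∧ c.mapDart e = d := by
  rcases stretchVert_cases x with ⟨u, rfl⟩ | ⟨e, j, k', rfl⟩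
  · exact absurd h Sum.inl_ne_inr
  · rw [stretchMapFun_internalVert, internalVert_eq_iff] at h
    rcases h with ⟨rfl, rfl⟩ | ⟨rfl, rfl⟩
    · exact ⟨e, k', rfl, rfl⟩
    · refine ⟨e.symm, ?_, internalVert_eq_iff.2 (Or.inr ⟨rfl, rfl⟩), mapDart_symm c e⟩
      rw [SimpleGraph.Dart.edge_symm, ← mapDart_edge]
      rwa [SimpleGraph.Dart.edge_symm] at k

lemma mapDart_symm_ne (e : G.Dart) : c.mapDart e.symm ≠ c.mapDart e := by
  rw [mapDart_symm]
  exact (c.mapDart e).symm_ne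

lemma fst_eq_of_stretch_adj {ℓ' : Sym2 V → ℕ} {v : V} {e : G.Dart} {h : 0 + 1 < ℓ' e.edge}
    (ha : (Stretch G ℓ').Adj (branchVert G ℓ' v) (internalVert G ℓ' e 0 h))
    (hv : c v = c e.fst) : e.fst = v := by
  rcases (stretch_adj.1 ha).2 with ⟨d, k, rfl, hd⟩ | h
  · rcases mk_eq_mk_iff.1 hd with ⟨rfl, _⟩ | ⟨rfl, _⟩
    · rfl
    · exact absurd hv.symm (c.map_adj e.adj).ne
  · exact h.elim

lemma dart_eq_of_stretch_adj {ℓ' : Sym2 V → ℕ} {e e' : G.Dart} {i j : ℕ}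
    {h : i + 1 < ℓ' e.edge} {h' : j + 1 < ℓ' e'.edge}
    (ha : (Stretch G ℓ').Adj (internalVert G ℓ' e i h) (internalVert G ℓ' e' j h'))
    (he : c.mapDart e = c.mapDart e') : e' = e := by
  have key : e' = e ∨ e' = e.symm := by
    rcases (stretch_adj.1 ha).2 with ⟨d, n, k, h₁, h₂⟩ | ⟨d, n, k, h₁, h₂⟩ <;>
    · rcases mk_eq_mk_iff.1 h₁ with ⟨rfl, _⟩ | ⟨h₁, _⟩ <;>
      rcases mk_eq_mk_iff.1 h₂ with ⟨h₂, _⟩ | ⟨h₂, _⟩ <;>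
      simp_all [SimpleGraph.Dart.symm_involutive.injective.eq_iff]
  rcases key with rfl | rfl
  · rfl
  · exact absurd he.symm (mapDart_symm_ne c e)

end Map

section Section

variable {G : SimpleGraph V} {H : SimpleGraph W} {c : G →g H} {ℓ : Sym2 W → ℕ}

lemma map_map_of_comp_eq_id {φ : H →g G} (hφ : ⇑c ∘ ⇑φ = id) (e : Sym2 W) :
    Sym2.map c (Sym2.map φ e) = e := by
  rw [Sym2.map_map, hφ, Sym2.map_id, id]

lemma mapDart_mapDart_of_comp_eq_id {φ : H →g G} (hφ : ⇑c ∘ ⇑φ = id) (d : H.Dart) :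
    c.mapDart (φ.mapDart d) = d :=
  SimpleGraph.Dart.ext _ _ (Prod.ext (congrFun hφ d.fst) (congrFun hφ d.snd))

/-- The vertex map between stretched graphs induced by a section `φ` of `c`. -/
def stretchSectionFun (φ : H →g G) (hφ : ⇑c ∘ ⇑φ = id) :
    StretchVert H ℓ → StretchVert G (fun e => ℓ (Sym2.map c e))
  | Sum.inl u => branchVert G _ (φ u)
  | Sum.inr q => Quotient.lift
      (fun p : StretchCarrier H ℓ => internalVert G (fun e => ℓ (Sym2.map c e))
        (φ.mapDart p.1.1) p.1.2 (by
          rw [mapDart_edge, map_map_of_comp_eq_id hφ]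
          exact p.2))
      (by
        rintro a b (rfl | rfl)
        · rfl
        · refine internalVert_eq_iff.2 (Or.inr ⟨mapDart_symm φ a.1.1, ?_⟩)
          rw [mapDart_edge, map_map_of_comp_eq_id hφ]
          rfl) q

lemma stretchSectionFun_branchVert (φ : H →g G) (hφ : ⇑c ∘ ⇑φ = id) (u : W) :
    stretchSectionFun φ hφ (branchVert H ℓ u) = branchVert G _ (φ u) :=
  rfl

lemma stretchSectionFun_internalVert (φ : H →g G) (hφ : ⇑c ∘ ⇑φ = id) (d : H.Dart) (i : ℕ)
    (h : i + 1 < ℓ d.edge) :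
    stretchSectionFun φ hφ (internalVert H ℓ d i h) =
      internalVert G (fun e => ℓ (Sym2.map c e)) (φ.mapDart d) i
        (by rwa [mapDart_edge, map_map_of_comp_eq_id hφ]) :=
  rfl

lemma stretchMapFun_stretchSectionFun (φ : H →g G) (hφ : ⇑c ∘ ⇑φ = id) (x : StretchVert H ℓ) :
    stretchMapFun c ℓ (stretchSectionFun φ hφ x) = x := by
  rcases stretchVert_cases x with ⟨u, rfl⟩ | ⟨d, i, h, rfl⟩
  · rw [stretchSectionFun_branchVert, stretchMapFun_branchVert]
    exact congrArg _ (congrFun hφ u)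
  · rw [stretchSectionFun_internalVert, stretchMapFun_internalVert]
    exact internalVert_eq_iff.2 (Or.inl ⟨(mapDart_mapDart_of_comp_eq_id hφ d).symm, rfl⟩)

lemma stretchBase_stretchSectionFun (φ : H →g G) (hφ : ⇑c ∘ ⇑φ = id) {x y : StretchVert H ℓ}
    (h : stretchBase H ℓ x y) :
    stretchBase G (fun e => ℓ (Sym2.map c e))
      (stretchSectionFun φ hφ x) (stretchSectionFun φ hφ y) := by
  rcases x with u | q <;> rcases y with v | q'
  · refine ⟨φ.map_adj h.1, ?_⟩
    change ℓ (Sym2.map c (Sym2.map φ s(u, v))) = 1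
    rw [map_map_of_comp_eq_id hφ]
    exact h.2
  · obtain ⟨d, k, rfl, rfl⟩ := h
    exact ⟨φ.mapDart d, by simpa only [mapDart_edge, map_map_of_comp_eq_id hφ] using k, rfl, rfl⟩
  · exact h.elim
  · obtain ⟨d, i, k, rfl, rfl⟩ := h
    exact ⟨φ.mapDart d, i, by simpa only [mapDart_edge, map_map_of_comp_eq_id hφ] using k, rfl, rfl⟩

/-- The homomorphism between stretched graphs induced by a section `φ` of `c`. -/
def stretchSection (φ : H →g G) (hφ : ⇑c ∘ ⇑φ = id) :
    Stretch H ℓ →g Stretch G (fun e => ℓ (Sym2.map c e)) where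
  toFun := stretchSectionFun φ hφ
  map_rel' h := stretch_adj.2
    ⟨(LeftInverse.injective (stretchMapFun_stretchSectionFun φ hφ)).ne (stretch_adj.1 h).1,
      (stretch_adj.1 h).2.imp (stretchBase_stretchSectionFun φ hφ)
        (stretchBase_stretchSectionFun φ hφ)⟩

/-- A section of `stretchMapFun c ℓ` traverses, along the path replacing a dart `d`, the path
replacing a single dart of `G`. -/
lemma exists_dart_of_stretch_section
    (φ' : Stretch H ℓ →g Stretch G (fun e => ℓ (Sym2.map c e)))
    (hφ' : ∀ x, stretchMapFun c ℓ (φ' x) = x) (hℓ : ∀ e ∈ H.edgeSet, 0 < ℓ e) {g : W → V}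
    (hg : ∀ w, φ' (branchVert H ℓ w) = branchVert G _ (g w)) (hcg : ∀ w, c (g w) = w)
    (d : H.Dart) :
    ∃ e : G.Dart, e.fst = g d.fst ∧ e.snd = g d.snd ∧
      ∀ i h, ∃ h', φ' (internalVert H ℓ d i h) =
        internalVert G (fun e => ℓ (Sym2.map c e)) e i h' := by
  rcases (Nat.succ_le_of_lt (hℓ d.edge d.edge_mem)).eq_or_lt' with h1 | h1
  · have ha := φ'.map_adj (stretch_adj_branchVert.2 ⟨d.adj, h1⟩)
    rw [hg, hg] at ha
    exact ⟨⟨(g d.fst, g d.snd), (stretch_adj_branchVert.1 ha).1⟩, rfl, rfl,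
      fun i h => by omega⟩
  · obtain ⟨e, k, he, hd⟩ := exists_internalVert_of_stretchMapFun_eq c
      (hφ' (internalVert H ℓ d 0 h1))
    have hfst : c e.fst = d.fst := congrArg (·.fst) hd
    have hsnd : c e.snd = d.snd := congrArg (·.snd) hd
    have hint : ∀ i h, ∃ h', φ' (internalVert H ℓ d i h) =
        internalVert G (fun e => ℓ (Sym2.map c e)) e i h' := by
      intro i
      induction i with
      | zero => exact fun _ => ⟨k, he⟩
      | succ i ih =>
        intro h
        obtain ⟨h₀, hi⟩ := ih (by omega)
        obtain ⟨e', k', he', hd'⟩ := exists_internalVert_of_stretchMapFun_eq c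
          (hφ' (internalVert H ℓ d (i + 1) h))
        have ha := φ'.map_adj (stretch_adj_internalVert_succ d i h)
        rw [hi, he'] at ha
        obtain rfl := dart_eq_of_stretch_adj c ha (hd.trans hd'.symm)
        exact ⟨k', he'⟩
    refine ⟨e, ?_, ?_, hint⟩
    · have ha := φ'.map_adj (stretch_adj_branchVert_internalVert d h1)
      rw [hg, he] at ha
      exact fst_eq_of_stretch_adj c ha ((hcg _).trans hfst.symm)
    · have h1' : 1 < ℓ d.symm.edge := by rwa [SimpleGraph.Dart.edge_symm]
      have ha := φ'.map_adj (stretch_adj_branchVert_internalVert d.symm h1')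
      obtain ⟨k₂, hlast⟩ := hint (ℓ d.edge - 2) (by omega)
      have hlen : ℓ d.edge = ℓ (Sym2.map c e.edge) := by rw [← hd, mapDart_edge]
      have hflip : internalVert G (fun e => ℓ (Sym2.map c e)) e (ℓ d.edge - 2) k₂ =
          internalVert G (fun e => ℓ (Sym2.map c e)) e.symm 0
            (by rw [SimpleGraph.Dart.edge_symm]; exact k) :=
        internalVert_eq_iff.2 (Or.inr ⟨rfl, by rw [hlen]; omega⟩)
      rw [hg, ← internalVert_symm d h1, hlast, hflip] at ha
      exact fst_eq_of_stretch_adj c ha ((hcg _).trans hsnd.symm)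

lemma exists_eq_stretchSection
    (φ' : Stretch H ℓ →g Stretch G (fun e => ℓ (Sym2.map c e)))
    (hφ' : ∀ x, stretchMapFun c ℓ (φ' x) = x) (hℓ : ∀ e ∈ H.edgeSet, 0 < ℓ e) :
    ∃ (φ : H →g G) (hφ : ⇑c ∘ ⇑φ = id), stretchSection φ hφ = φ' := by
  choose g hg hcg using fun w => exists_branchVert_of_stretchMapFun_eq c (hφ' (branchVert H ℓ w))
  have key := exists_dart_of_stretch_section φ' hφ' hℓ hg hcg
  let φ : H →g G := ⟨g, fun {u v} h => by
    obtain ⟨e, h₁, h₂, _⟩ := key ⟨(u, v), h⟩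
    have := e.adj
    rwa [h₁, h₂] at this⟩
  refine ⟨φ, funext hcg, RelHom.ext fun x => ?_⟩
  rcases stretchVert_cases x with ⟨u, rfl⟩ | ⟨d, i, h, rfl⟩
  · exact (hg u).symm
  · obtain ⟨e, h₁, h₂, hint⟩ := key d
    obtain rfl : e = φ.mapDart d := SimpleGraph.Dart.ext _ _ (Prod.ext h₁ h₂)
    exact (hint i h).2.symm

end Section

/-- Let `c : G →g H` be a surjective homomorphism, and let `ℓ` assign a
positive length to every edge of `H`. Let `H'` be obtained from `H` by replacing every
edge `e` by a path of length `ℓ e`, let `G'` be obtained from `G` by replacing every edge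
`{u,v}` by a path of length `ℓ {c u, c v}`, and let `c'` be the canonical colouring.
Then the number of homomorphisms `φ : H →g G` with `c ∘ φ = id` equals the number of
homomorphisms `φ' : H' →g G'` with `c' ∘ φ' = id`. -/
theorem stmt_1 {V W : Type} [Fintype V] [Fintype W]
    (G : SimpleGraph V) (H : SimpleGraph W) (c : G →g H) (hc : Function.Surjective ⇑c)
    (ℓ : Sym2 W → ℕ) (hℓ : ∀ e ∈ H.edgeSet, 0 < ℓ e) :
    Nat.card {φ : H →g G // ⇑c ∘ ⇑φ = id}
      = Nat.card {φ' : Stretch H ℓ →g Stretch G (fun e => ℓ (Sym2.map ⇑c e)) //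
          stretchMapFun c ℓ ∘ ⇑φ' = id} := by
  refine Nat.card_congr (Equiv.ofBijective
    (fun φ => ⟨stretchSection φ.1 φ.2, funext (stretchMapFun_stretchSectionFun φ.1 φ.2)⟩) ⟨?_, ?_⟩)
  · intro φ ψ h
    refine Subtype.ext (RelHom.ext fun u => branchVert_injective G (fun e => ℓ (Sym2.map c e)) ?_)
    exact DFunLike.congr_fun (Subtype.ext_iff.1 h) (branchVert H ℓ u)
  · rintro ⟨φ', hφ'⟩
    obtain ⟨φ, hφ, rfl⟩ := exists_eq_stretchSection φ' (congrFun hφ') hℓ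
    exact ⟨⟨φ, hφ⟩, rfl⟩

end Fmz
end

section
/- Let r ∈ ℕ₀ and let F be a graph satisfying both of the following conditions: (i) for every two distinct vertices u and v of F, each of degree at least 3, the length of every simple path in F from u to v is divisible by r+1; and (ii) every cycle of F has length divisible by r+1 and of length at least 3(r+1). Then F is isomorphic to a subgraph of the r-subdivision of a complete graph on at most (r+1)·|V(F)| vertices. -/
open SimpleGraph Function

namespace Fmz

variable {V : Type*} {W : Type*} {V₁ : Type*} {V₂ : Type*} {VH : Type*}


section EdgeVert

variable {W : Type*} (r : ℕ) {a b c d : W}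

/-- The `j`-th vertex, counted from `a`, of the path that replaces the edge `ab` in the
`r`-subdivision of the complete graph. -/
def edgeVert (h : a ≠ b) (j : ℕ) : StretchVert (completeGraph W) (fun _ => r + 1) :=
  if j = 0 then Sum.inl a
  else if hj : j - 1 + 1 < r + 1 then
    Sum.inr (Quotient.mk (StretchSetoid (completeGraph W) (fun _ => r + 1))
      ⟨(⟨(a, b), h⟩, j - 1), hj⟩)
  else Sum.inl b

@[simp]
lemma edgeVert_zero (h : a ≠ b) : edgeVert r h 0 = Sum.inl a := rfl

@[simp]
lemma edgeVert_last (h : a ≠ b) : edgeVert r h (r + 1) = Sum.inl b :=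
  (if_neg r.succ_ne_zero).trans (dif_neg (by omega))

lemma edgeVert_inner (h : a ≠ b) {i : ℕ} (hi : i + 1 < r + 1) :
    edgeVert r h (i + 1) = Sum.inr (Quotient.mk (StretchSetoid (completeGraph W) (fun _ => r + 1))
      ⟨(⟨(a, b), h⟩, i), hi⟩) :=
  (if_neg i.succ_ne_zero).trans (dif_pos hi)

lemma mk_eq_mk_iff_s9 {G : SimpleGraph W} {ℓ : Sym2 W → ℕ} {x y : StretchCarrier G ℓ} :
    Quotient.mk (StretchSetoid G ℓ) x = Quotient.mk (StretchSetoid G ℓ) y ↔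
      y = x ∨ y = flipC G ℓ x :=
  Quotient.eq

lemma edgeVert_inner_eq_inner {h : a ≠ b} {h' : c ≠ d} {i j : ℕ} (hi : i + 1 < r + 1)
    (hj : j + 1 < r + 1) (heq : edgeVert r h (i + 1) = edgeVert r h' (j + 1)) :
    (a = c ∧ b = d ∧ i = j) ∨ (a = d ∧ b = c) := by
  rw [edgeVert_inner r h hi, edgeVert_inner r h' hj] at heq
  rcases mk_eq_mk_iff_s9.1 (Sum.inr.inj heq) with h1 | h1
  · have h2 := congrArg Subtype.val h1
    simp only [Prod.mk.injEq, Dart.ext_iff] at h2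
    exact Or.inl ⟨h2.1.1.symm, h2.1.2.symm, h2.2.symm⟩
  · have h2 := congrArg Subtype.val h1
    simp only [flipC, Prod.mk.injEq, Dart.ext_iff, Dart.symm, Prod.swap] at h2
    exact Or.inr ⟨h2.1.2.symm, h2.1.1.symm⟩

lemma edgeVert_inner_ne_inl (h : a ≠ b) {i : ℕ} (hi : i + 1 < r + 1) (w : W) :
    edgeVert r h (i + 1) ≠ Sum.inl w := by
  rw [edgeVert_inner r h hi]
  exact Sum.inr_ne_inl

lemma edgeVert_injOn (h : a ≠ b) : Set.InjOn (edgeVert r h) {j | j ≤ r + 1} := by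
  have key : ∀ i j, i < j → j ≤ r + 1 → edgeVert r h i ≠ edgeVert r h j := by
    intro i j hij hj heq
    obtain ⟨j, rfl⟩ := Nat.exists_eq_add_one.2 (Nat.zero_lt_of_lt hij)
    rcases hj.lt_or_eq with hj | hj
    · rcases i with _ | i
      · exact edgeVert_inner_ne_inl r h hj a heq.symm
      · rcases edgeVert_inner_eq_inner r (by omega) hj heq with h1 | h1
        · omega
        · exact h h1.1
    · rw [hj, edgeVert_last] at heq
      rcases i with _ | i
      · exact h (Sum.inl.inj heq)
      · exact edgeVert_inner_ne_inl r h (by omega) b heq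
  intro i hi j hj heq
  by_contra hne
  rcases Nat.lt_or_gt_of_ne hne with hlt | hlt
  · exact key i j hlt hj heq
  · exact key j i hlt hi heq.symm

lemma edgeVert_adj_succ (h : a ≠ b) {j : ℕ} (hj : j < r + 1) :
    (Subdiv (completeGraph W) r).Adj (edgeVert r h j) (edgeVert r h (j + 1)) := by
  refine (fromRel_adj _ _ _).2 ⟨fun heq => ?_, ?_⟩
  · have := edgeVert_injOn r h (show j ≤ r + 1 by omega) (show j + 1 ≤ r + 1 by omega) heq
    omega
  rcases (show j + 1 ≤ r + 1 from hj).lt_or_eq with hj' | hj'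
  · left
    rw [edgeVert_inner r h hj']
    rcases j with _ | j
    · exact ⟨⟨(a, b), h⟩, by simpa using hj', rfl, rfl⟩
    · rw [edgeVert_inner r h hj]
      exact ⟨⟨(a, b), h⟩, j, by omega, rfl, rfl⟩
  · rw [hj', edgeVert_last]
    rcases j with _ | j
    · left
      exact ⟨h, hj'.symm⟩
    · right
      rw [edgeVert_inner r h hj]
      refine ⟨⟨(b, a), h.symm⟩, show 1 < r + 1 by omega, rfl, mk_eq_mk_iff_s9.2 (Or.inr ?_)⟩
      refine Subtype.ext (Prod.ext rfl ?_)
      simp only [flipC]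
      omega

end EdgeVert

section Isolate

variable {V : Type*} {F : SimpleGraph V} {S : Set V} {u v : V}

/-- The graph obtained from `F` by removing all edges that meet `S`. -/
def isolate (F : SimpleGraph V) (S : Set V) : SimpleGraph V where
  Adj u v := F.Adj u v ∧ u ∉ S ∧ v ∉ S
  symm := ⟨fun _ _ h => ⟨h.1.symm, h.2.2, h.2.1⟩⟩
  loopless := ⟨fun _ h => h.1.ne rfl⟩

lemma isolate_le : isolate F S ≤ F := fun _ _ h => h.1

lemma notMem_of_mem_support_isolate (q : (isolate F S).Walk u v) (hu : u ∉ S) :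
    ∀ x ∈ q.support, x ∉ S := by
  induction q with
  | nil => simpa using hu
  | cons h q ih =>
    intro x hx
    rcases List.mem_cons.1 hx with rfl | hx
    · exact hu
    · exact ih h.2.2 x hx

lemma length_eq_zero_of_mem_isolate (q : (isolate F S).Walk u v) (hu : u ∈ S) :
    q.length = 0 := by
  cases q with
  | nil => rfl
  | cons h q => exact absurd hu h.2.1

end Isolate

section Threads

variable {V : Type*} {r : ℕ} {F : SimpleGraph V} {B : Set V}

/-- `B` may serve as a set of branch vertices of `F`: other vertices have degree at most two,
and lengths of paths between members of `B` and of cycles are suitable for `r`-subdivisions. -/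
structure IsBranchSet (r : ℕ) (F : SimpleGraph V) (B : Set V) : Prop where
  eq_or_eq_of_adj : ∀ v ∉ B, ∀ x y z, F.Adj v x → F.Adj v y → F.Adj v z → x ≠ y → z = x ∨ z = y
  dvd_length_path : ∀ u ∈ B, ∀ v ∈ B, ∀ p : F.Walk u v, p.IsPath → (r + 1) ∣ p.length
  dvd_length_cycle : ∀ (x : V) (p : F.Walk x x), p.IsCycle → (r + 1) ∣ p.length
  le_length_cycle : ∀ (x : V) (p : F.Walk x x), p.IsCycle → 3 * (r + 1) ≤ p.length

/-- A path that starts in the branch set `B`, has no inner vertices in `B`, and either has length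
`r + 1` or is shorter and ends in a leaf outside `B`. -/
structure IsThread (r : ℕ) (F : SimpleGraph V) (B : Set V) {b t : V} (p : F.Walk b t) : Prop where
  isPath : p.IsPath
  start_mem : b ∈ B
  getVert_notMem : ∀ j, 0 < j → j < p.length → p.getVert j ∉ B
  length_pos : 0 < p.length
  snd_notMem : p.getVert 1 ∉ B
  length_le : p.length ≤ r + 1
  leaf : p.length < r + 1 → t ∉ B ∧ ∀ y, F.Adj t y → y = p.getVert (p.length - 1)

lemma IsBranchSet.eq_of_isPath (hB : IsBranchSet r F B) {u v : V} {p q : F.Walk u v}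
    (hp : p.IsPath) (hq : q.IsPath) (hlen : p.length + q.length < 3 * (r + 1)) : p = q := by
  by_contra hne
  obtain ⟨w, -, -, c, hc, hle⟩ := hp.exists_isCycle_length_le_add_of_ne hq hne
  have := hB.le_length_cycle w c hc
  omega

lemma IsBranchSet.exists_isThread (hB : IsBranchSet r F B) {b w : V} (hb : b ∈ B) (hw : w ∉ B)
    (hbw : F.Adj b w) : ∃ (t : V) (p : F.Walk b t), IsThread r F B p := by
  classical
  by_contra! hno
  have key : ∀ k, k ≤ r → ∃ (t : V) (p : F.Walk b t), p.IsPath ∧ p.length = k + 1 ∧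
      (∀ j, 0 < j → j < p.length → p.getVert j ∉ B) ∧ p.getVert 1 ∉ B := by
    intro k
    induction k with
    | zero =>
      intro _
      refine ⟨w, hbw.toWalk, Walk.IsPath.of_adj hbw, rfl, ?_, hw⟩
      intro j h0 h1
      have : hbw.toWalk.length = 1 := rfl
      omega
    | succ k ih =>
      intro hk
      obtain ⟨t, p, hp, hlen, hin, hsnd⟩ := ih (by omega)
      have ht : t ∉ B := by
        intro ht
        have := Nat.le_of_dvd (by omega) (hB.dvd_length_path b hb t ht p hp)
        omega
      have hnl : ∃ y, F.Adj t y ∧ y ≠ p.getVert (p.length - 1) := by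
        by_contra! hl
        exact hno t p ⟨hp, hb, hin, by omega, hsnd, by omega, fun _ => ⟨ht, hl⟩⟩
      obtain ⟨z, hz, hzp⟩ := hnl
      have hzs : z ∉ p.support := by
        intro hzs
        have hd := hp.dropUntil hzs
        have hle := p.length_dropUntil_le_length hzs
        have heq := hB.eq_of_isPath hd (Walk.IsPath.of_adj hz.symm)
          (by have : hz.symm.toWalk.length = 1 := rfl
              omega)
        have h1 : (p.dropUntil z hzs).length = 1 := by rw [heq]; rfl
        have h2 : (p.takeUntil z hzs).length + (p.dropUntil z hzs).length = p.length := by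
          rw [← Walk.length_append, Walk.take_spec]
        apply hzp
        rw [← p.getVert_length_takeUntil hzs]
        congr 1
        omega
      refine ⟨z, p.concat hz, hp.concat hzs hz, by rw [Walk.length_concat, hlen], ?_, ?_⟩
      · intro j h0 h1
        rw [Walk.length_concat] at h1
        rw [Walk.concat_eq_append, Walk.getVert_append]
        split_ifs with hj
        · exact hin j h0 hj
        · rw [show j - p.length = 0 by omega]
          simpa using ht
      · rw [Walk.concat_eq_append, Walk.getVert_append]
        split_ifs with hj
        · exact hsnd
        · have : p.length = 1 := by omega
          rw [this]
          simpa using ht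
  obtain ⟨t, p, hp, hlen, hin, hsnd⟩ := key r le_rfl
  exact hno t p ⟨hp, hb, hin, by omega, hsnd, by omega, fun h => by omega⟩

/-- The vertices of a thread that are mapped to subdivision vertices. -/
def threadInner (r : ℕ) {b t : V} (p : F.Walk b t) : Set V :=
  {v | ∃ j, 0 < j ∧ j ≤ p.length ∧ j < r + 1 ∧ p.getVert j = v}

variable {b t : V} {p : F.Walk b t}

lemma IsThread.start_ne_end (hp : IsThread r F B p) : b ≠ t := by
  rintro rfl
  have := hp.length_pos
  rw [(Walk.isPath_iff_nil.1 hp.isPath).eq_nil] at this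
  simp at this

lemma IsThread.notMem_of_mem_inner (hp : IsThread r F B p) {v : V} (hv : v ∈ threadInner r p) :
    v ∉ B := by
  obtain ⟨j, h0, hj, hjr, rfl⟩ := hv
  rcases hj.lt_or_eq with hj | hj
  · exact hp.getVert_notMem j h0 hj
  · rw [hj, Walk.getVert_length]
    exact (hp.leaf (hj ▸ hjr)).1

lemma IsThread.length_eq (hp : IsThread r F B p) (ht : t ∉ threadInner r p) :
    p.length = r + 1 := by
  by_contra hne
  exact ht ⟨p.length, hp.length_pos, le_rfl, lt_of_le_of_ne hp.length_le hne, p.getVert_length⟩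

lemma IsThread.mem_support (hp : IsThread r F B p) {v : V} (hv : v ∈ p.support) :
    v = b ∨ v = t ∨ v ∈ threadInner r p := by
  obtain ⟨j, rfl, hj⟩ := Walk.mem_support_iff_exists_getVert.1 hv
  rcases Nat.eq_zero_or_pos j with rfl | h0
  · simp
  rcases hj.lt_or_eq with hj | rfl
  · exact Or.inr (Or.inr ⟨j, h0, hj.le, hj.trans_le hp.length_le, rfl⟩)
  · simp

lemma IsThread.eq_of_adj (hB : IsBranchSet r F B) (hp : IsThread r F B p) {j : ℕ} (h0 : 0 < j)
    (hj : j ≤ p.length) (hjr : j < r + 1) {y : V} (hy : F.Adj (p.getVert j) y) :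
    y = p.getVert (j - 1) ∨ (j + 1 ≤ p.length ∧ y = p.getVert (j + 1)) := by
  rcases hj.lt_or_eq with hj | rfl
  · have h1 := p.adj_getVert_succ hj
    have h2 := p.adj_getVert_succ (show j - 1 < p.length by omega)
    rw [show j - 1 + 1 = j by omega] at h2
    have hne : p.getVert (j - 1) ≠ p.getVert (j + 1) := by
      intro h
      have := hp.isPath.getVert_injOn (show j - 1 ≤ p.length by omega)
        (show j + 1 ≤ p.length by omega) h
      omega
    rcases hB.eq_or_eq_of_adj _ (hp.getVert_notMem j h0 hj) _ _ _ h2.symm h1 hy hne with h | h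
    · exact Or.inl h
    · exact Or.inr ⟨hj, h⟩
  · rw [Walk.getVert_length] at hy
    exact Or.inl ((hp.leaf hjr).2 y hy)

lemma IsThread.dvd_length_of_start (hB : IsBranchSet r F B) (hp : IsThread r F B p) {v : V}
    (hv : v ∈ B) (q : (isolate F (threadInner r p)).Walk t v) (hq : q.IsPath) :
    (r + 1) ∣ q.length := by
  classical
  by_cases ht : t ∈ threadInner r p
  · simp [length_eq_zero_of_mem_isolate q ht]
  rcases Nat.eq_zero_or_pos r with rfl | hr
  · simp
  have hlen := hp.length_eq ht
  have hav := notMem_of_mem_support_isolate q ht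
  have hq' : (q.mapLe isolate_le).IsPath := hq.mapLe isolate_le
  have hsupp : (q.mapLe (isolate_le (F := F))).support = q.support :=
    Walk.support_mapLe_eq_support ..
  rw [← Walk.length_mapLe (isolate_le (F := F)) q]
  rw [← hsupp] at hav
  generalize q.mapLe (isolate_le (F := F)) = q at hq' hav ⊢
  clear hsupp hq
  have htail : ∀ {s : V} (q' : F.Walk t s), q'.IsPath → t ∉ q'.support.tail := by
    intro s q' hq'
    have := hq'.support_nodup
    rw [← Walk.cons_tail_support, List.nodup_cons] at this
    exact this.1
  by_cases hbq : b ∈ q.support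
  · have h1 := hB.dvd_length_path b hp.start_mem v hv _ (hq'.dropUntil hbq)
    have h2 : (p.append (q.takeUntil b hbq)).IsCycle := by
      refine hp.isPath.isCycle_append (hq'.takeUntil hbq) ?_ (Or.inl (by omega))
      intro x hx hx'
      have hbt : b ∉ p.support.tail := by
        have := hp.isPath.support_nodup
        rw [← Walk.cons_tail_support, List.nodup_cons] at this
        exact this.1
      rcases hp.mem_support (List.mem_of_mem_tail hx) with rfl | rfl | h
      · exact hbt hx
      · exact htail _ (hq'.takeUntil hbq) hx'
      · exact hav x (q.support_takeUntil_subset_support hbq (List.mem_of_mem_tail hx')) h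
    have h3 := hB.dvd_length_cycle _ _ h2
    rw [Walk.length_append, hlen] at h3
    rw [← q.take_spec hbq, Walk.length_append]
    exact dvd_add ((Nat.dvd_add_right dvd_rfl).1 h3) h1
  · have h2 : (p.append q).IsPath := by
      rw [Walk.isPath_def, Walk.support_append, List.nodup_append']
      refine ⟨hp.isPath.support_nodup, hq'.support_nodup.tail, ?_⟩
      intro x hx hx'
      rcases hp.mem_support hx with rfl | rfl | h
      · exact hbq (List.mem_of_mem_tail hx')
      · exact htail q hq' hx'
      · exact hav x (List.mem_of_mem_tail hx') h
    have h3 := hB.dvd_length_path b hp.start_mem v hv _ h2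
    rw [Walk.length_append, hlen] at h3
    exact (Nat.dvd_add_right dvd_rfl).1 h3

lemma IsThread.isBranchSet_isolate (hB : IsBranchSet r F B) (hp : IsThread r F B p) :
    IsBranchSet r (isolate F (threadInner r p)) (B ∪ {v | v ∈ p.support}) where
  eq_or_eq_of_adj v hv x y z hx hy hz :=
    hB.eq_or_eq_of_adj v (fun h => hv (Or.inl h)) x y z hx.1 hy.1 hz.1
  dvd_length_cycle x q hq := by
    rw [← Walk.length_mapLe (isolate_le (F := F)) q]
    exact hB.dvd_length_cycle x _ (hq.mapLe isolate_le)
  le_length_cycle x q hq := by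
    rw [← Walk.length_mapLe (isolate_le (F := F)) q]
    exact hB.le_length_cycle x _ (hq.mapLe isolate_le)
  dvd_length_path := by
    have hmem : ∀ u ∈ B ∪ {v | v ∈ p.support}, u ∈ B ∨ u = t ∨ u ∈ threadInner r p := by
      rintro u (hu | hu)
      · exact Or.inl hu
      · rcases hp.mem_support hu with rfl | h
        · exact Or.inl hp.start_mem
        · exact Or.inr h
    intro u hu v hv q hq
    rcases hmem u hu with hu₁ | rfl | hu₁
    · rcases hmem v hv with hv₁ | rfl | hv₁
      · rw [← Walk.length_mapLe (isolate_le (F := F)) q]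
        exact hB.dvd_length_path u hu₁ v hv₁ _ (hq.mapLe isolate_le)
      · rw [← Walk.length_reverse]
        exact hp.dvd_length_of_start hB hu₁ _ hq.reverse
      · rw [← Walk.length_reverse, length_eq_zero_of_mem_isolate _ hv₁]
        exact dvd_zero _
    · rcases hmem v hv with hv₁ | rfl | hv₁
      · exact hp.dvd_length_of_start hB hv₁ _ hq
      · rw [(Walk.isPath_iff_nil.1 hq).eq_nil]
        exact dvd_zero _
      · rw [← Walk.length_reverse, length_eq_zero_of_mem_isolate _ hv₁]
        exact dvd_zero _
    · rw [length_eq_zero_of_mem_isolate _ hu₁]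
      exact dvd_zero _

end Threads

section Embedding

variable {V W : Type*} {r : ℕ} {F : SimpleGraph V} {B : Set V} {e : V ↪ W}

/-- An embedding of `F` into the `r`-subdivision of a complete graph that maps the vertices in `B`
to the prescribed branch vertices, and uses the subdivision vertices of an edge between such
branch vertices only if their preimages are joined by a path of length `r + 1`. -/
structure IsSubdivEmbedding (r : ℕ) (F : SimpleGraph V) (B : Set V) (e : V ↪ W)
    (f : V → StretchVert (completeGraph W) (fun _ => r + 1)) : Prop where
  injective : Injective f
  map_adj : ∀ u v, F.Adj u v → (Subdiv (completeGraph W) r).Adj (f u) (f v)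
  map_branch : ∀ v ∈ B, f v = Sum.inl (e v)
  exists_path : ∀ v, ∀ s ∈ B, ∀ t ∈ B, ∀ (h : e s ≠ e t) (j : ℕ), j + 1 < r + 1 →
    f v = edgeVert r h (j + 1) → ∃ q : F.Walk s t, q.IsPath ∧ q.length = r + 1

lemma IsBranchSet.isSubdivEmbedding_of_forall_mem (hB : IsBranchSet r F B) (e : V ↪ W)
    (hall : ∀ v, v ∈ B) : IsSubdivEmbedding r F B e (fun v => Sum.inl (e v)) where
  injective := Sum.inl_injective.comp e.injective
  map_adj u v huv := by
    have hne : e u ≠ e v := e.injective.ne huv.ne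
    have hr : r = 0 := by
      have := hB.dvd_length_path u (hall u) v (hall v) _ (Walk.IsPath.of_adj huv)
      have h1 : huv.toWalk.length = 1 := rfl
      rw [h1, Nat.dvd_one] at this
      omega
    subst hr
    simpa using edgeVert_adj_succ 0 hne (j := 0) (by omega)
  map_branch _ _ := rfl
  exists_path v s _ t _ h j hj heq := absurd heq.symm (edgeVert_inner_ne_inl r h hj _)

/-- Reroute the inner vertices of the thread `p` along the subdivided edge joining its ends. -/
noncomputable def extendThread (e : V ↪ W) {b t : V} (p : F.Walk b t) (h : e b ≠ e t)
    (f : V → StretchVert (completeGraph W) (fun _ => r + 1)) (v : V) :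
    StretchVert (completeGraph W) (fun _ => r + 1) :=
  open Classical in
  if hv : v ∈ threadInner r p then edgeVert r h hv.choose else f v

variable {b t : V} {p : F.Walk b t}
  {f : V → StretchVert (completeGraph W) (fun _ => r + 1)}

lemma extendThread_of_notMem (h : e b ≠ e t) {v : V} (hv : v ∉ threadInner r p) :
    extendThread e p h f v = f v :=
  dif_neg hv

lemma IsThread.extendThread_getVert (hp : IsThread r F B p) (h : e b ≠ e t)
    (hb : f b = Sum.inl (e b)) (ht : f t = Sum.inl (e t)) {j : ℕ} (hj : j ≤ p.length) :
    extendThread e p h f (p.getVert j) = edgeVert r h j := by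
  unfold extendThread
  split_ifs with hv
  · have hc := hv.choose_spec
    rw [hp.isPath.getVert_injOn hc.2.1 hj hc.2.2.2]
  · rcases Nat.eq_zero_or_pos j with rfl | h0
    · simpa using hb
    have hjr : ¬ j < r + 1 := fun hjr => hv ⟨j, h0, hj, hjr, rfl⟩
    have hle := hp.length_le
    rw [Walk.getVert_of_length_le p (show p.length ≤ j by omega), ht,
      show j = r + 1 by omega, edgeVert_last]

lemma IsThread.isSubdivEmbedding_extendThread (hB : IsBranchSet r F B) (hp : IsThread r F B p)
    (h : e b ≠ e t) (hf : IsSubdivEmbedding r (isolate F (threadInner r p))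
      (B ∪ {v | v ∈ p.support}) e f) :
    IsSubdivEmbedding r F B e (extendThread e p h f) := by
  have hbB : b ∈ B ∪ {v | v ∈ p.support} := Or.inr p.start_mem_support
  have htB : t ∈ B ∪ {v | v ∈ p.support} := Or.inr p.end_mem_support
  have hg : ∀ j, j ≤ p.length → extendThread e p h f (p.getVert j) = edgeVert r h j :=
    fun j hj => hp.extendThread_getVert h (hf.map_branch b hbB) (hf.map_branch t htB) hj
  have hsep : ∀ u ∈ threadInner r p, ∀ v ∉ threadInner r p,
      extendThread e p h f u ≠ extendThread e p h f v := by
    rintro u ⟨j, h0, hj, hjr, rfl⟩ v hv heq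
    rw [hg j hj, extendThread_of_notMem h hv] at heq
    obtain ⟨i, rfl⟩ := Nat.exists_eq_add_one.2 h0
    obtain ⟨q, hq, hql⟩ := hf.exists_path v b hbB t htB h i hjr heq.symm
    have htI : t ∉ threadInner r p := by
      intro htI
      have := length_eq_zero_of_mem_isolate q.reverse htI
      rw [Walk.length_reverse] at this
      omega
    have hbI : b ∉ threadInner r p := fun hbI => hp.notMem_of_mem_inner hbI hp.start_mem
    have hpq := hB.eq_of_isPath hp.isPath (hq.mapLe isolate_le)
      (by rw [Walk.length_mapLe, hp.length_eq htI]; omega)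
    have hmem : p.getVert (i + 1) ∈ (q.mapLe (isolate_le (F := F))).support :=
      hpq ▸ p.getVert_mem_support (i + 1)
    rw [Walk.support_mapLe_eq_support] at hmem
    exact notMem_of_mem_support_isolate q hbI _ hmem ⟨i + 1, h0, hj, hjr, rfl⟩
  have hadj : ∀ u ∈ threadInner r p, ∀ v, F.Adj u v →
      (Subdiv (completeGraph W) r).Adj (extendThread e p h f u) (extendThread e p h f v) := by
    rintro u ⟨j, h0, hj, hjr, rfl⟩ v huv
    obtain ⟨i, rfl⟩ := Nat.exists_eq_add_one.2 h0
    rcases hp.eq_of_adj hB h0 hj hjr huv with rfl | ⟨hj', rfl⟩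
    · rw [hg _ hj, hg _ (by omega)]
      exact (edgeVert_adj_succ r h (by omega)).symm
    · rw [hg _ hj, hg _ hj']
      exact edgeVert_adj_succ r h hjr
  constructor
  · intro u v huv
    by_cases hu : u ∈ threadInner r p <;> by_cases hv : v ∈ threadInner r p
    · obtain ⟨j, h0, hj, hjr, rfl⟩ := hu
      obtain ⟨k, -, hk, hkr, rfl⟩ := hv
      rw [hg j hj, hg k hk] at huv
      rw [edgeVert_injOn r h hjr.le hkr.le huv]
    · exact absurd huv (hsep u hu v hv)
    · exact absurd huv.symm (hsep v hv u hu)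
    · rw [extendThread_of_notMem h hu, extendThread_of_notMem h hv] at huv
      exact hf.injective huv
  · intro u v huv
    by_cases hu : u ∈ threadInner r p
    · exact hadj u hu v huv
    by_cases hv : v ∈ threadInner r p
    · exact (hadj v hv u huv.symm).symm
    rw [extendThread_of_notMem h hu, extendThread_of_notMem h hv]
    exact hf.map_adj u v ⟨huv, hu, hv⟩
  · intro v hv
    rw [extendThread_of_notMem h fun hvI => hp.notMem_of_mem_inner hvI hv]
    exact hf.map_branch v (Or.inl hv)
  · intro v s hs t' ht' h' j hj heq
    by_cases hv : v ∈ threadInner r p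
    · obtain ⟨k, h0, hk, hkr, rfl⟩ := hv
      obtain ⟨i, rfl⟩ := Nat.exists_eq_add_one.2 h0
      rw [hg _ hk] at heq
      have hlen : t ∈ B → p.length = r + 1 :=
        fun ht => hp.length_eq fun htI => hp.notMem_of_mem_inner htI ht
      rcases edgeVert_inner_eq_inner r hkr hj heq with ⟨h1, h2, -⟩ | ⟨h1, h2⟩
      · obtain rfl := e.injective h1
        obtain rfl := e.injective h2
        exact ⟨p, hp.isPath, hlen ht'⟩
      · obtain rfl := e.injective h1
        obtain rfl := e.injective h2
        exact ⟨p.reverse, hp.isPath.reverse, by rw [Walk.length_reverse, hlen hs]⟩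
    · rw [extendThread_of_notMem h hv] at heq
      obtain ⟨q, hq, hql⟩ := hf.exists_path v s (Or.inl hs) t' (Or.inl ht') h' j hj heq
      exact ⟨q.mapLe isolate_le, hq.mapLe isolate_le, by rw [Walk.length_mapLe, hql]⟩

lemma IsBranchSet.insert_of_forall_not_adj (hB : IsBranchSet r F B) {v : V} (hv : v ∉ B)
    (hsep : ∀ b ∈ B, ∀ w ∉ B, ¬ F.Adj b w) : IsBranchSet r F (insert v B) where
  eq_or_eq_of_adj u hu := hB.eq_or_eq_of_adj u fun h => hu (Or.inr h)
  dvd_length_cycle := hB.dvd_length_cycle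
  le_length_cycle := hB.le_length_cycle
  dvd_length_path := by
    have hno : ∀ u ∈ B, ∀ _ : F.Walk u v, False := by
      intro u hu q
      obtain ⟨d, -, h1, h2⟩ := q.exists_boundary_dart B hu hv
      exact hsep _ h1 _ h2 d.adj
    rintro x (rfl | hx) y (rfl | hy) q hq
    · rw [(Walk.isPath_iff_nil.1 hq).eq_nil]
      exact dvd_zero _
    · exact (hno y hy q.reverse).elim
    · exact (hno x hx q).elim
    · exact hB.dvd_length_path x hx y hy q hq

theorem IsBranchSet.exists_isSubdivEmbedding [Finite V] (hB : IsBranchSet r F B) (e : V ↪ W) :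
    ∃ f, IsSubdivEmbedding r F B e f := by
  induction hk : Bᶜ.ncard using Nat.strong_induction_on generalizing F B with
  | _ k ih =>
    subst hk
    by_cases hall : ∀ v, v ∈ B
    · exact ⟨_, hB.isSubdivEmbedding_of_forall_mem e hall⟩
    by_cases hsep : ∀ b ∈ B, ∀ w ∉ B, ¬ F.Adj b w
    · push Not at hall
      obtain ⟨v, hv⟩ := hall
      obtain ⟨f, hf⟩ := ih _ (Set.ncard_lt_ncard
        (compl_lt_compl_iff_lt.2 (Set.ssubset_insert hv))) (hB.insert_of_forall_not_adj hv hsep) rfl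
      exact ⟨f, hf.injective, hf.map_adj, fun u hu => hf.map_branch u (Or.inr hu),
        fun u s hs t ht => hf.exists_path u s (Or.inr hs) t (Or.inr ht)⟩
    · push Not at hsep
      obtain ⟨b, hb, w, hw, hbw⟩ := hsep
      obtain ⟨t, p, hp⟩ := hB.exists_isThread hb hw hbw
      have hss : B ⊂ B ∪ {v | v ∈ p.support} :=
        (Set.ssubset_iff_of_subset Set.subset_union_left).2
          ⟨p.getVert 1, Or.inr (p.getVert_mem_support 1), hp.snd_notMem⟩
      obtain ⟨f, hf⟩ := ih _ (Set.ncard_lt_ncard (compl_lt_compl_iff_lt.2 hss))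
        (hp.isBranchSet_isolate hB) rfl
      exact ⟨_, hp.isSubdivEmbedding_extendThread hB (e.injective.ne hp.start_ne_end) hf⟩

end Embedding

/-- Let `r ∈ ℕ` and let `F` be a graph such that (i) the length of every
simple path between two distinct vertices of degree at least `3` is divisible by `r + 1`,
and (ii) every cycle of `F` has length divisible by `r + 1` and at least `3(r+1)`. Then
`F` is isomorphic to a subgraph of the `r`-subdivision of a complete graph on at most
`(r+1)·|V(F)|` vertices. -/
theorem stmt_9 {V : Type} [Fintype V] [DecidableEq V] (r : ℕ) (F : SimpleGraph V)
    [DecidableRel F.Adj]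
    (hpath : ∀ u v : V, u ≠ v → 3 ≤ F.degree u → 3 ≤ F.degree v →
      ∀ p : F.Walk u v, p.IsPath → (r + 1) ∣ p.length)
    (hcycle : ∀ (x : V) (p : F.Walk x x), p.IsCycle →
      (r + 1) ∣ p.length ∧ 3 * (r + 1) ≤ p.length) :
    ∃ n ≤ (r + 1) * Fintype.card V,
      ∃ f : F →g Subdiv (completeGraph (Fin n)) r, Function.Injective f := by
  classical
  have hB : IsBranchSet r F {v | 3 ≤ F.degree v} := by
    refine ⟨?_, ?_, fun x p hp => (hcycle x p hp).1, fun x p hp => (hcycle x p hp).2⟩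
    · intro v hv x y z hx hy hz hxy
      by_contra! hne
      refine hv ?_
      rw [Set.mem_ofPred_eq, ← card_neighborFinset_eq_degree,
        ← Finset.card_eq_three.2 ⟨x, y, z, hxy, hne.1.symm, hne.2.symm, rfl⟩]
      refine Finset.card_le_card fun w hw => ?_
      simp only [Finset.mem_insert, Finset.mem_singleton] at hw
      rw [mem_neighborFinset]
      rcases hw with rfl | rfl | rfl <;> assumption
    · intro u hu v hv p hp
      by_cases huv : u = v
      · subst huv
        rw [(Walk.isPath_iff_nil.1 hp).eq_nil]
        exact dvd_zero _
      · exact hpath u v huv hu hv p hp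
  obtain ⟨f, hf⟩ := hB.exists_isSubdivEmbedding (Fintype.equivFin V).toEmbedding
  exact ⟨Fintype.card V, Nat.le_mul_of_pos_left _ r.succ_pos,
    ⟨f, fun {u v} h => hf.map_adj u v h⟩, hf.injective⟩

end Fmz
end

section
/- There exists a function R : ℕ³ → ℕ such that every graph H satisfies m(H) ≤ R(m_ind(H), ω(H), β_ind(H)). Equivalently, for every k ∈ ℕ there exists N ∈ ℕ such that every graph whose matching number is at least N contains a clique of size k, or an induced subgraph isomorphic to the complete bipartite graph K_{k,k}, or an induced matching of size k. -/
open SimpleGraph Function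

namespace Fmz

variable {V : Type*} {W : Type*} {V₁ : Type*} {V₂ : Type*} {VH : Type*}


/-- `M` is a set of pairwise disjoint edges of `G` (a matching, viewed as an edge set). -/
def IsMatchingSet {α : Type*} (G : SimpleGraph α) (M : Finset (Sym2 α)) : Prop :=
  ↑M ⊆ G.edgeSet ∧ (M : Set (Sym2 α)).Pairwise (fun e f => ∀ v : α, ¬(v ∈ e ∧ v ∈ f))

/-- `M` is an induced matching of `G`: a matching such that the subgraph of `G` induced
by the endpoints of `M` contains exactly the edges of `M`. -/
def IsInducedMatchingSet {α : Type*} (G : SimpleGraph α) (M : Finset (Sym2 α)) : Prop :=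
  IsMatchingSet G M ∧ ∀ u v : α, G.Adj u v →
    (∃ e ∈ M, u ∈ e) → (∃ e ∈ M, v ∈ e) → s(u, v) ∈ M


theorem exists_endHomogeneous_list {ι C : Type*} [Fintype C] (c : ι → ι → C) (L : ℕ) :
    ∀ s : Finset ι, (Fintype.card C + 1) ^ L ≤ s.card →
      ∃ l : List (ι × C), l.length = L ∧ (∀ p ∈ l, p.1 ∈ s) ∧
        l.Pairwise (fun p q => p.1 ≠ q.1 ∧ c p.1 q.1 = p.2) := by
  classical
  induction L with
  | zero => exact fun s _ => ⟨[], rfl, by simp, List.Pairwise.nil⟩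
  | succ L ih =>
    intro s hs
    have hpos : 0 < (Fintype.card C + 1) ^ L := by positivity
    rw [pow_succ] at hs
    obtain ⟨x, hx⟩ : s.Nonempty := Finset.card_pos.1 (by nlinarith)
    have : Nonempty C := ⟨c x x⟩
    obtain ⟨d, -, hd⟩ := Finset.exists_le_card_fiber_of_mul_le_card_of_maps_to
      (s := s.erase x) (t := (Finset.univ : Finset C)) (f := c x)
      (n := (Fintype.card C + 1) ^ L) (fun _ _ => Finset.mem_univ _) Finset.univ_nonempty (by
        rw [Finset.card_erase_of_mem hx, Finset.card_univ]
        refine Nat.le_sub_of_add_le ?_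
        nlinarith)
    obtain ⟨l, hl, hmem, hp⟩ := ih _ hd
    refine ⟨(x, d) :: l, by simp [hl], ?_, List.pairwise_cons.2 ⟨?_, hp⟩⟩
    · intro p hpl
      rcases List.mem_cons.1 hpl with rfl | h
      · exact hx
      · exact Finset.mem_of_mem_erase (Finset.mem_filter.1 (hmem p h)).1
    · intro q hq
      have h := Finset.mem_filter.1 (hmem q hq)
      exact ⟨(Finset.ne_of_mem_erase h.1).symm, h.2⟩

/-- Ramsey's theorem for edge colourings with finitely many colours, allowing the colour of a pair
to depend on its orientation. -/
theorem exists_homogeneous {ι C : Type*} [Fintype C] [Nonempty C] (c : ι → ι → C) (n : ℕ)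
    (s : Finset ι) (hs : (Fintype.card C + 1) ^ (Fintype.card C * n) ≤ s.card) :
    ∃ (f : Fin n → ι) (d : C), (∀ i, f i ∈ s) ∧
      ∀ i j, i < j → f i ≠ f j ∧ c (f i) (f j) = d := by
  classical
  obtain ⟨l, hl, hmem, hp⟩ := exists_endHomogeneous_list c _ s hs
  obtain ⟨d, -, hd⟩ := Finset.exists_le_card_fiber_of_mul_le_card_of_maps_to
    (s := (Finset.univ : Finset (Fin l.length))) (t := (Finset.univ : Finset C))
    (f := fun i => (l.get i).2) (n := n) (fun _ _ => Finset.mem_univ _) Finset.univ_nonempty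
    (by simp [hl])
  obtain ⟨t, ht, htc⟩ := Finset.exists_subset_card_eq hd
  refine ⟨fun i => (l.get (t.orderEmbOfFin htc i)).1, d,
    fun i => hmem _ (List.get_mem _ _), fun i j hij => ?_⟩
  have h := List.pairwise_iff_get.1 hp _ _ ((t.orderEmbOfFin htc).strictMono hij)
  have hi := (Finset.mem_filter.1 (ht (t.orderEmbOfFin_mem htc i))).2
  exact ⟨h.1, h.2.trans hi⟩

theorem exists_isNClique_of_adj {α : Type*} {G : SimpleGraph α} {k : ℕ} (x : Fin k → α)
    (h : ∀ i j, i < j → G.Adj (x i) (x j)) : ∃ s : Finset α, G.IsNClique k s := by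
  classical
  have hadj : ∀ i j, i ≠ j → G.Adj (x i) (x j) := fun i j hij =>
    hij.lt_or_gt.elim (h i j) fun hji => (h j i hji).symm
  have hinj : Injective x := fun i j hij => by
    by_contra hne
    exact (hadj i j hne).ne hij
  refine ⟨Finset.univ.image x, ?_, by simp [Finset.card_image_of_injective _ hinj]⟩
  rintro _ hu _ hv hne
  obtain ⟨i, -, rfl⟩ := Finset.mem_image.1 hu
  obtain ⟨j, -, rfl⟩ := Finset.mem_image.1 hv
  exact hadj i j fun hij => hne (congrArg x hij)

theorem nonempty_completeBipartiteGraph_embedding {α β γ : Type*} {G : SimpleGraph α}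
    (u : β → α) (v : γ → α) (hu : Injective u) (hv : Injective v)
    (huu : ∀ i j, ¬G.Adj (u i) (u j)) (hvv : ∀ i j, ¬G.Adj (v i) (v j))
    (huv : ∀ i j, G.Adj (u i) (v j)) : Nonempty (completeBipartiteGraph β γ ↪g G) := by
  refine ⟨⟨⟨Sum.elim u v, hu.sumElim hv fun i j => (huv i j).ne⟩, ?_⟩⟩
  rintro (i | i) (j | j)
  · simpa using huu i j
  · simpa using huv i j
  · simpa using (huv j i).symm
  · simpa using hvv i j

theorem exists_isInducedMatchingSet {α : Type*} {G : SimpleGraph α} {k : ℕ} (x y : Fin k → α)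
    (hxy : ∀ i, G.Adj (x i) (y i)) (hxx : ∀ i j, ¬G.Adj (x i) (x j))
    (hyy : ∀ i j, ¬G.Adj (y i) (y j)) (hne : ∀ i j, i ≠ j → ¬G.Adj (x i) (y j)) :
    ∃ M : Finset (Sym2 α), IsInducedMatchingSet G M ∧ M.card = k := by
  classical
  have hdisj : ∀ i j v, v ∈ s(x i, y i) → v ∈ s(x j, y j) → i = j := by
    intro i j v hi hj
    by_contra hij
    rcases Sym2.mem_iff.1 hi with rfl | rfl <;> rcases Sym2.mem_iff.1 hj with h | h
    · exact hne i j hij (h ▸ hxy j)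
    · exact hyy j i (h ▸ hxy i)
    · exact hxx i j (h ▸ hxy i)
    · exact hne j i (Ne.symm hij) (h ▸ hxy j)
  have hinj : Injective fun i => s(x i, y i) := fun i j hij =>
    hdisj i j (x i) (Sym2.mem_mk_left _ _) (by
      have : s(x i, y i) = s(x j, y j) := hij
      rw [← this]
      exact Sym2.mem_mk_left _ _)
  refine ⟨Finset.univ.image fun i => s(x i, y i), ⟨⟨?_, ?_⟩, ?_⟩,
    by simp [Finset.card_image_of_injective _ hinj]⟩
  · intro e he
    obtain ⟨i, -, rfl⟩ := Finset.mem_image.1 (Finset.mem_coe.1 he)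
    exact hxy i
  · intro e he f hf hef v hv
    obtain ⟨i, -, rfl⟩ := Finset.mem_image.1 (Finset.mem_coe.1 he)
    obtain ⟨j, -, rfl⟩ := Finset.mem_image.1 (Finset.mem_coe.1 hf)
    obtain rfl := hdisj i j v hv.1 hv.2
    exact hef rfl
  · rintro u v huv ⟨e, he, hue⟩ ⟨f, hf, hvf⟩
    obtain ⟨i, -, rfl⟩ := Finset.mem_image.1 he
    obtain ⟨j, -, rfl⟩ := Finset.mem_image.1 hf
    have key : i = j := by
      by_contra hij
      rcases Sym2.mem_iff.1 hue with rfl | rfl <;> rcases Sym2.mem_iff.1 hvf with rfl | rfl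
      · exact hxx i j huv
      · exact hne i j hij huv
      · exact hne j i (Ne.symm hij) huv.symm
      · exact hyy i j huv
    subst key
    rwa [← (Sym2.mem_and_mem_iff huv.ne).1 ⟨hue, hvf⟩]

theorem not_adj_of_lt {ι α : Type*} [LinearOrder ι] {G : SimpleGraph α} (x : ι → α)
    (h : ∀ i j, i < j → ¬G.Adj (x i) (x j)) (i j : ι) : ¬G.Adj (x i) (x j) := by
  rcases lt_trichotomy i j with hij | rfl | hij
  · exact h i j hij
  · exact G.irrefl
  · exact fun hadj => h j i hij hadj.symm

/-- **Ramsey-type bound of Curticapean–Marx.** For every `k` there is `N`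
such that every graph with matching number at least `N` contains a clique of size `k`, or
an induced complete bipartite subgraph `K_{k,k}`, or an induced matching of size `k`. -/
theorem stmt_12 (k : ℕ) : ∃ N : ℕ,
    ∀ (α : Type) [Fintype α] (G : SimpleGraph α),
      (∃ M : Finset (Sym2 α), IsMatchingSet G M ∧ N ≤ M.card) →
      ((∃ s : Finset α, G.IsNClique k s) ∨
        Nonempty (completeBipartiteGraph (Fin k) (Fin k) ↪g G) ∨
        (∃ M : Finset (Sym2 α), IsInducedMatchingSet G M ∧ M.card = k)) := by
  classical
  refine ⟨(Fintype.card (Bool × Bool × Bool × Bool) + 1) ^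
    (Fintype.card (Bool × Bool × Bool × Bool) * (k + k)), ?_⟩
  rintro α _ G ⟨M, ⟨hMG, hM⟩, hcard⟩
  let a : Sym2 α → α := fun e => e.out.1
  let b : Sym2 α → α := fun e => e.out.2
  have hab : ∀ e, s(a e, b e) = e := fun e => e.out_eq
  have ha : ∀ e, a e ∈ e := fun e => e.out_fst_mem
  have hb : ∀ e, b e ∈ e := fun e => e.out_snd_mem
  obtain ⟨f, ⟨d₁, d₂, d₃, d₄⟩, hfM, hf⟩ := exists_homogeneous
    (fun e e' => (decide (G.Adj (a e) (a e')), decide (G.Adj (b e) (b e')),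
      decide (G.Adj (a e) (b e')), decide (G.Adj (b e) (a e')))) (k + k) M hcard
  simp only [Prod.mk.injEq] at hf
  have hfinj : ∀ i j v, v ∈ f i → v ∈ f j → i = j := by
    intro i j v hi hj
    by_contra hij
    refine hM (hfM i) (hfM j) ?_ v ⟨hi, hj⟩
    exact (lt_or_gt_of_ne hij).elim (fun h => (hf i j h).1) fun h => (hf j i h).1.symm
  have hainj : Injective (a ∘ f) := fun i j h =>
    hfinj i j (a (f i)) (ha _) (by rw [show a (f i) = a (f j) from h]; exact ha _)
  have hbinj : Injective (b ∘ f) := fun i j h =>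
    hfinj i j (b (f i)) (hb _) (by rw [show b (f i) = b (f j) from h]; exact hb _)
  have hadj : ∀ i, G.Adj (a (f i)) (b (f i)) := fun i => by
    rw [← SimpleGraph.mem_edgeSet, hab]
    exact hMG (hfM i)
  let l : Fin k → Fin (k + k) := Fin.castAdd k
  let r : Fin k → Fin (k + k) := Fin.natAdd k
  have hl : StrictMono l := Fin.strictMono_castAdd k
  have hr : StrictMono r := Fin.strictMono_natAdd k
  have hlr : ∀ i j, l i < r j := fun i j => by
    simp only [l, r, Fin.lt_def, Fin.val_castAdd, Fin.val_natAdd]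
    omega
  cases d₁ with
  | true =>
    exact Or.inl (exists_isNClique_of_adj (a ∘ f ∘ l) fun i j hij =>
      of_decide_eq_true (hf _ _ (hl hij)).2.1)
  | false =>
  cases d₂ with
  | true =>
    exact Or.inl (exists_isNClique_of_adj (b ∘ f ∘ l) fun i j hij =>
      of_decide_eq_true (hf _ _ (hl hij)).2.2.1)
  | false =>
  have haa := not_adj_of_lt (a ∘ f) fun i j hij => of_decide_eq_false (hf i j hij).2.1
  have hbb := not_adj_of_lt (b ∘ f) fun i j hij => of_decide_eq_false (hf i j hij).2.2.1
  cases d₃ with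
  | true =>
    exact Or.inr (Or.inl (nonempty_completeBipartiteGraph_embedding (a ∘ f ∘ l) (b ∘ f ∘ r)
      (hainj.comp hl.injective) (hbinj.comp hr.injective) (fun _ _ => haa _ _)
      (fun _ _ => hbb _ _) fun i j => of_decide_eq_true (hf _ _ (hlr i j)).2.2.2.1))
  | false =>
  cases d₄ with
  | true =>
    exact Or.inr (Or.inl (nonempty_completeBipartiteGraph_embedding (b ∘ f ∘ l) (a ∘ f ∘ r)
      (hbinj.comp hl.injective) (hainj.comp hr.injective) (fun _ _ => hbb _ _)
      (fun _ _ => haa _ _) fun i j => of_decide_eq_true (hf _ _ (hlr i j)).2.2.2.2))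
  | false =>
  refine Or.inr (Or.inr (exists_isInducedMatchingSet (a ∘ f ∘ l) (b ∘ f ∘ l) (fun _ => hadj _)
    (fun _ _ => haa _ _) (fun _ _ => hbb _ _) fun i j hij => ?_))
  rcases hij.lt_or_gt with h | h
  · exact of_decide_eq_false (hf _ _ (hl h)).2.2.2.1
  · exact fun hadj' => of_decide_eq_false (hf _ _ (hl h)).2.2.2.2 hadj'.symm

end Fmz
end

section
/- Let H be a graph and let M_H be the square matrix with rational entries whose rows and columns are indexed by the fractures of H and whose entries are M_H[ρ,σ] = |Hom((H⤡ρ, c_ρ) → (H⤡σ, c_σ))|, the number of homomorphisms φ from the fractured graph H⤡ρ to the fractured graph H⤡σ satisfying c_σ ∘ φ = c_ρ. Then M_H is non-singular. -/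
open SimpleGraph Function

namespace Fmz

variable {V : Type*} {W : Type*} {V₁ : Type*} {V₂ : Type*} {VH : Type*}

/-- A fracture of `H` assigns to every vertex `v` a partition of the set of edges of `H`
incident to `v`. -/
def FractureOf (H : SimpleGraph VH) : Type _ :=
  ∀ v : VH, Setoid ↥(H.incidenceSet v)

/-- Vertices of the fractured graph: pairs `v^B` of a vertex `v` and a block `B` of the
partition of the edges incident to `v`. -/
def FracVert (H : SimpleGraph VH) (ρ : FractureOf H) : Type _ :=
  Σ v : VH, Quotient (ρ v)

/-- The fractured graph `H ⤡ ρ`: `v^B` and `u^{B'}` are adjacent iff `{u,v} ∈ E(H)`,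
`{u,v} ∈ B` and `{u,v} ∈ B'`. -/
def FracturedGraph (H : SimpleGraph VH) (ρ : FractureOf H) : SimpleGraph (FracVert H ρ) :=
  SimpleGraph.fromRel (fun a b => ∃ h : H.Adj a.1 b.1,
    a.2 = Quotient.mk (ρ a.1) ⟨s(a.1, b.1), (H.mk'_mem_incidenceSet_left_iff).2 h⟩ ∧
    b.2 = Quotient.mk (ρ b.1) ⟨s(a.1, b.1), (H.mk'_mem_incidenceSet_right_iff).2 h⟩)

/-- The canonical colouring of the fractured graph, mapping `v^B` to `v`. -/
def fracColor (H : SimpleGraph VH) (ρ : FractureOf H) : FracVert H ρ → VH :=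
  Sigma.fst

instance {α : Type*} [Finite α] : Finite (Setoid α) :=
  Finite.of_injective (fun s : Setoid α => (fun a b => s a b : α → α → Prop))
    (fun s t h => Setoid.ext fun a b => by
      have h' : (s a b : Prop) = (t a b : Prop) := congrFun (congrFun h a) b
      rw [h'])

instance {VH : Type*} [Finite VH] (H : SimpleGraph VH) : Finite (FractureOf H) := by
  unfold FractureOf
  infer_instance



noncomputable instance fractureFintype {α : Type*} [Finite α] (H : SimpleGraph α) :
    Fintype (FractureOf H) :=
  Fintype.ofFinite _

noncomputable instance fractureDecEq {α : Type*} (H : SimpleGraph α) :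
    DecidableEq (FractureOf H) :=
  Classical.decEq _


/-- A matrix indexed by a finite partial order which is upper triangular with respect to that
order and has non-zero diagonal entries is non-singular. -/
theorem det_ne_zero_of_upperTriangular_partialOrder {ι R : Type*} [Fintype ι] [DecidableEq ι]
    [PartialOrder ι] [CommRing R] [IsDomain R] (M : Matrix ι ι R)
    (hM : ∀ i j, M i j ≠ 0 → i ≤ j) (hdiag : ∀ i, M i i ≠ 0) : M.det ≠ 0 := by
  intro hdet
  obtain ⟨v, hv, hMv⟩ := Matrix.exists_mulVec_eq_zero_iff.2 hdet
  obtain ⟨i, hi⟩ := Set.Finite.exists_maximal (Set.toFinite {i | v i ≠ 0})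
    (Function.ne_iff.1 hv)
  have hsum : ∑ j, M i j * v j = 0 := congrFun hMv i
  rw [Finset.sum_eq_single i] at hsum
  · exact mul_ne_zero (hdiag i) hi.prop hsum
  · intro j _ hji
    by_contra hne
    obtain ⟨hMij, hvj⟩ := mul_ne_zero_iff.1 hne
    exact hji (hi.eq_of_le hvj (hM i j hMij)).symm
  · simp

/-- Fractures are ordered by refinement. -/
instance fracturePartialOrder {VH : Type*} (H : SimpleGraph VH) : PartialOrder (FractureOf H) :=
  inferInstanceAs (PartialOrder (∀ v : VH, Setoid ↥(H.incidenceSet v)))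

instance fracVertFinite {VH : Type*} [Finite VH] (H : SimpleGraph VH) (ρ : FractureOf H) :
    Finite (FracVert H ρ) :=
  have (v : VH) : Finite (Quotient (ρ v)) := Quotient.finite (ρ v)
  inferInstanceAs (Finite (Σ v : VH, Quotient (ρ v)))

/-- The endpoints of an edge of a fractured graph are determined by the underlying edge
of `H`. -/
theorem eq_mk_of_fracturedGraph_adj {VH : Type*} {H : SimpleGraph VH} {σ : FractureOf H}
    {u v : VH} {a : Quotient (σ v)} {b : Quotient (σ u)}
    (h : (FracturedGraph H σ).Adj ⟨v, a⟩ ⟨u, b⟩) (he : s(v, u) ∈ H.incidenceSet v) :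
    a = Quotient.mk (σ v) ⟨s(v, u), he⟩ := by
  rcases h.2 with ⟨_, ha, _⟩ | ⟨_, _, ha⟩
  · exact ha
  · refine ha.trans ?_
    congr 2
    exact Sym2.eq_swap

/-- A colour-preserving homomorphism maps the block of an edge to the block of the same edge. -/
theorem hom_apply_mk {VH : Type*} {H : SimpleGraph VH} {ρ σ : FractureOf H}
    (φ : FracturedGraph H ρ →g FracturedGraph H σ)
    (hφ : fracColor H σ ∘ ⇑φ = fracColor H ρ) (v : VH) (e : ↥(H.incidenceSet v)) :
    φ ⟨v, Quotient.mk (ρ v) e⟩ = ⟨v, Quotient.mk (σ v) e⟩ := by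
  obtain ⟨e, he⟩ := e
  obtain ⟨u, rfl⟩ := Sym2.mem_iff_exists.1 he.2
  have hvu : H.Adj v u := he.1
  have hu : s(v, u) ∈ H.incidenceSet u := H.mk'_mem_incidenceSet_right_iff.2 hvu
  have hadj : (FracturedGraph H ρ).Adj ⟨v, Quotient.mk (ρ v) ⟨s(v, u), he⟩⟩
      ⟨u, Quotient.mk (ρ u) ⟨s(v, u), hu⟩⟩ :=
    ⟨fun h => hvu.ne (congrArg Sigma.fst h), Or.inl ⟨hvu, rfl, rfl⟩⟩
  have himage := φ.map_adj hadj
  have hv₁ : (φ ⟨v, Quotient.mk (ρ v) ⟨s(v, u), he⟩⟩).1 = v := congrFun hφ _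
  have hu₁ : (φ ⟨u, Quotient.mk (ρ u) ⟨s(v, u), hu⟩⟩).1 = u := congrFun hφ _
  generalize φ ⟨v, Quotient.mk (ρ v) ⟨s(v, u), he⟩⟩ = x at *
  generalize φ ⟨u, Quotient.mk (ρ u) ⟨s(v, u), hu⟩⟩ = y at *
  obtain ⟨v', a⟩ := x
  obtain ⟨u', b⟩ := y
  obtain rfl : v' = v := hv₁
  obtain rfl : u' = u := hu₁
  exact congrArg (Sigma.mk v') (eq_mk_of_fracturedGraph_adj himage he)

/-- If there is a colour-preserving homomorphism between fractured graphs, then the fracture of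
the source refines that of the target. -/
theorem le_of_hom {VH : Type*} {H : SimpleGraph VH} {ρ σ : FractureOf H}
    (φ : FracturedGraph H ρ →g FracturedGraph H σ)
    (hφ : fracColor H σ ∘ ⇑φ = fracColor H ρ) : ρ ≤ σ := by
  intro v e f hef
  have h : (⟨v, Quotient.mk (σ v) e⟩ : FracVert H σ) = ⟨v, Quotient.mk (σ v) f⟩ := by
    rw [← hom_apply_mk φ hφ, ← hom_apply_mk φ hφ, Quotient.sound hef]
  exact Quotient.exact (eq_of_heq (Sigma.mk.inj h).2)

/-- The matrix `M_H`, indexed by the fractures of `H`, whose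
`(ρ,σ)`-entry is the number of homomorphisms `φ : H⤡ρ →g H⤡σ` with `c_σ ∘ φ = c_ρ`,
is non-singular. -/
theorem stmt_13 {α : Type} [Fintype α] (H : SimpleGraph α) :
    (Matrix.of (fun ρ σ : FractureOf H =>
      (Nat.card {φ : FracturedGraph H ρ →g FracturedGraph H σ //
        fracColor H σ ∘ ⇑φ = fracColor H ρ} : ℚ))).det ≠ 0 := by
  refine det_ne_zero_of_upperTriangular_partialOrder _ (fun ρ σ h => ?_) (fun ρ => ?_)
  · rw [Matrix.of_apply, Nat.cast_ne_zero, Nat.card_ne_zero] at h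
    obtain ⟨φ, hφ⟩ := h.1
    exact le_of_hom φ hφ
  · rw [Matrix.of_apply, Nat.cast_ne_zero, Nat.card_ne_zero]
    have : Finite (FracturedGraph H ρ →g FracturedGraph H ρ) := DFunLike.finite _
    exact ⟨⟨⟨SimpleGraph.Hom.id, rfl⟩⟩, inferInstance⟩

end Fmz
end

section
/- Let H be a graph with k edges and no isolated vertices. There exists a unique function a from the set of fractures of H to ℚ such that for every surjectively H-coloured graph (G̃, c̃), the number of colourful k-matchings of (G̃, c̃) equals the sum over all fractures ρ of H of a(ρ) · |Hom((H⤡ρ, c_ρ) → (G̃, c̃))|. Moreover, for the fracture ⊤ defined by ⊤_v = {E_H(v)} for every v ∈ V(H) (so that H⤡⊤ is isomorphic to H with canonical colouring the identity), this function satisfies a(⊤) = ∏_{v ∈ V(H)} (−1)^{deg_H(v)−1} · (deg_H(v)−1)!. -/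
open SimpleGraph Function

namespace Fmz

variable {V : Type*} {W : Type*} {V₁ : Type*} {V₂ : Type*} {VH : Type*}

/-- A colourful matching of a surjectively `H`-coloured graph `(G̃, c̃)` (where
`k = |E(H)|`): a set of pairwise disjoint edges of `G̃` whose edge-colours hit every edge
of `H` exactly once. -/
def IsColourfulMatching {α β : Type*} (H : SimpleGraph β) (Gt : SimpleGraph α)
    (ct : α → β) (M : Finset (Sym2 α)) : Prop :=
  ↑M ⊆ Gt.edgeSet ∧ (M : Set (Sym2 α)).Pairwise (fun e f => ∀ v : α, ¬(v ∈ e ∧ v ∈ f)) ∧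
    Set.BijOn (Sym2.map ct) ↑M H.edgeSet

/-- The linear identity expressing the number of colourful matchings of every
surjectively `H`-coloured graph as a linear combination of homomorphism counts from the
fractured graphs of `H`, with coefficients `a`. -/
def MatchingIdentity {β : Type} [Fintype β] (H : SimpleGraph β)
    (a : FractureOf H → ℚ) : Prop :=
  ∀ (α : Type) [Fintype α] (Gt : SimpleGraph α) (ct : Gt →g H),
    Function.Surjective ⇑ct →
    (Nat.card {M : Finset (Sym2 α) // IsColourfulMatching H Gt ⇑ct M} : ℚ)
      = ∑ ρ : FractureOf H, a ρ *
          (Nat.card {φ : FracturedGraph H ρ →g Gt // ⇑ct ∘ ⇑φ = fracColor H ρ} : ℚ)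


/-- The Möbius function `μ(⊥, s)` of the lattice of partitions of a finite type, as the signed
count of the permutations whose cycles are exactly the blocks of `s`. -/
noncomputable def partitionMoebius {E : Type*} [Finite E] (s : Setoid E) : ℚ :=
  open Classical in
  letI := Fintype.ofFinite E
  ∑ σ : Equiv.Perm E with Equiv.Perm.SameCycle.setoid σ = s, ((Equiv.Perm.sign σ : ℤ) : ℚ)

theorem sameCycle_setoid_le_iff {E : Type*} (σ : Equiv.Perm E) (t : Setoid E) :
    Equiv.Perm.SameCycle.setoid σ ≤ t ↔ ∀ x, t x (σ x) := by
  refine ⟨fun h x => h (show σ.SameCycle x (σ x) from ⟨1, by simp⟩), fun h x y => ?_⟩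
  have hinv : ∀ x, t x (σ⁻¹ x) := fun x => t.symm (by simpa using h (σ⁻¹ x))
  rintro ⟨n, rfl⟩
  induction n with
  | zero => exact t.refl _
  | succ n ih =>
    rw [add_comm, zpow_add, zpow_one]
    exact t.trans ih (h _)
  | pred n ih =>
    rw [sub_eq_add_neg, add_comm, zpow_add, zpow_neg_one]
    exact t.trans ih (hinv _)

open Classical in
theorem sum_partitionMoebius_le {E : Type*} [Finite E] [Fintype (Setoid E)] (t : Setoid E) :
    ∑ s : Setoid E with s ≤ t, partitionMoebius s = if t = ⊥ then 1 else 0 := by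
  let := Fintype.ofFinite E
  have key : ∑ s : Setoid E with s ≤ t, partitionMoebius s =
      ∑ σ : Equiv.Perm E with ∀ x, t x (σ x), ((Equiv.Perm.sign σ : ℤ) : ℚ) := by
    simp only [partitionMoebius]
    rw [← Finset.sum_fiberwise_of_maps_to (g := fun σ => Equiv.Perm.SameCycle.setoid σ)
      (t := Finset.univ.filter (· ≤ t))]
    · refine Finset.sum_congr rfl fun s hs => Finset.sum_congr ?_ fun _ _ => rfl
      ext σ
      simp only [Finset.mem_filter, Finset.mem_univ, true_and, ← sameCycle_setoid_le_iff] at hs ⊢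
      exact ⟨fun h => ⟨h ▸ hs, h⟩, fun h => h.2⟩
    · simp [sameCycle_setoid_le_iff]
  rw [key]
  split_ifs with ht
  · subst ht
    have : (Finset.univ.filter fun σ : Equiv.Perm E => ∀ x, (⊥ : Setoid E) x (σ x)) = {1} := by
      ext σ
      simp [Equiv.ext_iff, eq_comm]
    rw [this]
    simp
  · obtain ⟨a, b, hab, hne⟩ : ∃ a b, t a b ∧ a ≠ b := by
      by_contra! h
      exact ht (le_bot_iff.1 fun {x y} hxy => h x y hxy)
    have hswap : ∀ x, t x (Equiv.swap a b x) := fun x => by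
      by_cases hxa : x = a
      · subst hxa; simpa using hab
      by_cases hxb : x = b
      · subst hxb; simpa using t.symm hab
      rw [Equiv.swap_apply_of_ne_of_ne hxa hxb]
    refine Finset.sum_involution (fun σ _ => Equiv.swap a b * σ) (fun σ _ => ?_) (fun σ _ _ h => ?_)
      (fun σ hσ => ?_) (fun σ _ => ?_)
    · simp [Equiv.Perm.sign_swap hne]
    · exact hne (Equiv.swap_eq_one_iff.1 (mul_eq_right.1 h))
    · simp only [Finset.mem_filter, Finset.mem_univ, true_and] at hσ ⊢
      exact fun x => t.trans (hσ x) (hswap _)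
    · simp

theorem partitionMoebius_top {E : Type*} [Fintype E] [Nonempty E] :
    partitionMoebius (⊤ : Setoid E) =
      (-1) ^ (Fintype.card E - 1) * ((Fintype.card E - 1).factorial : ℚ) := by
  classical
  rw [partitionMoebius, Subsingleton.elim (Fintype.ofFinite E) ‹Fintype E›]
  rcases subsingleton_or_nontrivial E with hE | hE
  · have hall : ∀ σ : Equiv.Perm E, Equiv.Perm.SameCycle.setoid σ = ⊤ := fun σ => by
      ext x y
      exact iff_of_true (Subsingleton.elim x y ▸ Equiv.Perm.SameCycle.refl _ _) trivial
    have h1 : Fintype.card E = 1 :=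
      le_antisymm (Fintype.card_le_one_iff_subsingleton.2 hE) Fintype.card_pos
    simp [hall, h1]
  · have h2 : 2 ≤ Fintype.card E := Fintype.one_lt_card
    have hiff : ∀ σ : Equiv.Perm E, Equiv.Perm.SameCycle.setoid σ = ⊤ ↔
        σ.cycleType = {Fintype.card E} := by
      intro σ
      constructor
      · intro h
        have hon : σ.IsCycleOn Set.univ := ⟨Set.bijOn_univ.2 σ.bijective, fun x _ y _ =>
          (h ▸ (trivial : (⊤ : Setoid E) x y) : Equiv.Perm.SameCycle.setoid σ x y)⟩
        have hc : σ.IsCycle := Equiv.Perm.isCycle_iff_exists_isCycleOn.2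
          ⟨_, Set.nontrivial_univ, hon, fun _ _ => trivial⟩
        rw [hc.cycleType]
        rw [Multiset.singleton_inj, Finset.card_eq_iff_eq_univ]
        ext x
        simpa using hon.apply_ne Set.nontrivial_univ (Set.mem_univ x)
      · intro h
        have hc : σ.IsCycle := Equiv.Perm.card_cycleType_eq_one.1 (by simp [h])
        rw [hc.cycleType, Multiset.singleton_inj, Finset.card_eq_iff_eq_univ] at h
        ext x y
        have hx : ∀ x, σ x ≠ x := fun x => Equiv.Perm.mem_support.1 (h ▸ Finset.mem_univ x)
        exact iff_of_true (hc.sameCycle (hx x) (hx y)) trivial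
    simp only [hiff]
    have hsign : ∀ σ ∈ Finset.univ.filter (fun σ : Equiv.Perm E => σ.cycleType = {Fintype.card E}),
        ((Equiv.Perm.sign σ : ℤ) : ℚ) = (-1) ^ (Fintype.card E - 1) := by
      intro σ hσ
      rw [Equiv.Perm.sign_of_cycleType, (Finset.mem_filter.1 hσ).2]
      obtain ⟨n, hn⟩ := Nat.exists_eq_add_of_le h2
      rw [hn]
      simp [pow_add, pow_succ]
    rw [Finset.sum_congr rfl hsign, Finset.sum_const,
      Equiv.Perm.card_of_cycleType_singleton h2 le_rfl]
    simp [mul_comm]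

theorem eq_of_sum_le_eq {P : Type*} [Fintype P] [PartialOrder P] [DecidableLE P] {a b : P → ℚ}
    (h : ∀ t, ∑ s with s ≤ t, a s = ∑ s with s ≤ t, b s) : a = b := by
  classical
  funext t
  induction t using WellFoundedLT.induction with
  | ind t ih =>
    have ht := h t
    have hmem : t ∈ Finset.univ.filter (· ≤ t) := by simp
    rw [← Finset.add_sum_erase _ _ hmem, ← Finset.add_sum_erase _ _ hmem,
      Finset.sum_congr rfl (g := b)] at ht
    · exact add_right_cancel ht
    · intro s hs
      simp only [Finset.mem_erase, Finset.mem_filter, Finset.mem_univ, true_and] at hs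
      exact ih s (lt_of_le_of_ne hs.2 hs.1)

open Classical in
theorem sum_prod_partitionMoebius_le {ι : Type*} [Fintype ι] {E : ι → Type*} [∀ i, Finite (E i)]
    [Fintype (∀ i, Setoid (E i))] (t : ∀ i, Setoid (E i)) [hdec : Decidable (t = ⊥)] :
    ∑ s : (∀ i, Setoid (E i)) with s ≤ t, ∏ i, partitionMoebius (s i) =
      if t = ⊥ then (1 : ℚ) else 0 := by
  let (i : ι) : Fintype (Setoid (E i)) := Fintype.ofFinite _
  calc
    _ = ∑ s ∈ Fintype.piFinset fun i => {r : Setoid (E i) | r ≤ t i},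
          ∏ i, partitionMoebius (s i) := by
        refine Finset.sum_congr ?_ fun _ _ => rfl
        ext s
        simp [Pi.le_def]
    _ = ∏ i, if t i = ⊥ then (1 : ℚ) else 0 := by
        rw [← Finset.prod_univ_sum]
        simp_rw [sum_partitionMoebius_le]
    _ = _ := by
        rw [Finset.prod_ite_zero]
        simp [funext_iff]

theorem fracturedGraph_adj_iff {H : SimpleGraph VH} {ρ : FractureOf H} {u v : VH}
    {p : Quotient (ρ u)} {q : Quotient (ρ v)} :
    (FracturedGraph H ρ).Adj ⟨u, p⟩ ⟨v, q⟩ ↔ u ≠ v ∧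
      ∃ (e : Sym2 VH) (hu : e ∈ H.incidenceSet u) (hv : e ∈ H.incidenceSet v),
        p = Quotient.mk (ρ u) ⟨e, hu⟩ ∧ q = Quotient.mk (ρ v) ⟨e, hv⟩ := by
  refine (SimpleGraph.fromRel_adj _ _ _).trans ?_
  constructor
  · rintro ⟨-, ⟨h, hp, hq⟩ | ⟨h, hq, hp⟩⟩
    · exact ⟨h.ne, _, _, _, hp, hq⟩
    · exact ⟨h.ne.symm, _, _, _, hp, hq⟩
  · rintro ⟨hne, e, he, he', hp, hq⟩
    obtain rfl : e = s(u, v) := (Sym2.mem_and_mem_iff hne).1 ⟨he.2, he'.2⟩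
    exact ⟨fun h => hne (congrArg Sigma.fst h), Or.inl ⟨he.1, hp, hq⟩⟩

/-- Colour-preserving homomorphisms from the finest fractured graph `H ⤡ ⊥`, given by the images
of the pairs `(v, e)` with `e` an edge incident to `v`. -/
abbrev HalfEdgeMap (H : SimpleGraph VH) (Gt : SimpleGraph V) (ct : V → VH) : Type _ :=
  {x : ∀ v, H.incidenceSet v → V // (∀ v e, ct (x v e) = v) ∧
    ∀ (u v : VH) (e : Sym2 VH) (hu : e ∈ H.incidenceSet u) (hv : e ∈ H.incidenceSet v),
      u ≠ v → Gt.Adj (x u ⟨e, hu⟩) (x v ⟨e, hv⟩)}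

/-- The fracture identifying the half-edges at a vertex that have the same image. -/
def HalfEdgeMap.kernel {H : SimpleGraph VH} {Gt : SimpleGraph V} {ct : V → VH}
    (x : HalfEdgeMap H Gt ct) : FractureOf H :=
  fun v => Setoid.ker (x.1 v)

instance (H : SimpleGraph VH) : PartialOrder (FractureOf H) :=
  inferInstanceAs (PartialOrder (∀ v, Setoid (H.incidenceSet v)))

instance (H : SimpleGraph VH) : OrderBot (FractureOf H) :=
  inferInstanceAs (OrderBot (∀ v, Setoid (H.incidenceSet v)))

/-- Colour-preserving homomorphisms from `H ⤡ ρ` are the half-edge maps that are constant on the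
blocks of `ρ`. -/
def fracturedHomEquiv (H : SimpleGraph VH) (Gt : SimpleGraph V) (ct : V → VH) (ρ : FractureOf H) :
    {φ : FracturedGraph H ρ →g Gt // ct ∘ φ = fracColor H ρ} ≃
      {x : HalfEdgeMap H Gt ct // ρ ≤ x.kernel} where
  toFun φ := ⟨⟨fun v e => φ.1 ⟨v, Quotient.mk _ e⟩, fun v e => congrFun φ.2 _,
    fun u v e hu hv hne => φ.1.map_adj (fracturedGraph_adj_iff.2 ⟨hne, e, hu, hv, rfl, rfl⟩)⟩,
    fun v e e' h => congrArg (fun q => φ.1 ⟨v, q⟩) (Quotient.sound h)⟩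
  invFun x := ⟨⟨fun p => Quotient.lift (x.1.1 p.1) (fun _ _ h => x.2 p.1 h) p.2, by
    rintro ⟨u, p⟩ ⟨v, q⟩ h
    obtain ⟨hne, e, hu, hv, rfl, rfl⟩ := fracturedGraph_adj_iff.1 h
    exact x.1.2.2 u v e hu hv hne⟩, by
    funext ⟨v, q⟩
    induction q using Quotient.ind
    exact x.1.2.1 v _⟩
  left_inv φ := by
    ext ⟨v, q⟩
    induction q using Quotient.ind
    rfl
  right_inv x := rfl

namespace HalfEdgeMap

variable {H : SimpleGraph VH} {Gt : SimpleGraph V} {ct : V → VH}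

theorem apply_eq_apply (x : HalfEdgeMap H Gt ct) {v v' : VH} {e : H.incidenceSet v}
    {e' : H.incidenceSet v'} (hv : v = v') (he : e.1 = e'.1) : x.1 v e = x.1 v' e' := by
  subst hv
  rw [Subtype.ext he]

/-- The edges of `Gt` picked out by a half-edge map. -/
def edges (x : HalfEdgeMap H Gt ct) : Set (Sym2 V) :=
  {m | ∃ (u v : VH) (h : H.Adj u v), m = s(x.1 u ⟨s(u, v), H.mk'_mem_incidenceSet_left_iff.2 h⟩,
    x.1 v ⟨s(u, v), H.mk'_mem_incidenceSet_right_iff.2 h⟩)}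

theorem edges_eq_of_map_eq (x : HalfEdgeMap H Gt ct) {m : Sym2 V} (hm : m ∈ x.edges)
    {u v : VH} (h : H.Adj u v) (hc : m.map ct = s(u, v)) :
    m = s(x.1 u ⟨s(u, v), H.mk'_mem_incidenceSet_left_iff.2 h⟩,
      x.1 v ⟨s(u, v), H.mk'_mem_incidenceSet_right_iff.2 h⟩) := by
  obtain ⟨u', v', h', rfl⟩ := hm
  rw [Sym2.map_mk, x.2.1, x.2.1, Sym2.eq_iff] at hc
  obtain ⟨rfl, rfl⟩ | ⟨rfl, rfl⟩ := hc
  · rfl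
  · rw [Sym2.eq_swap]
    simp only [Sym2.eq_swap (a := u') (b := v')]

theorem bijOn_edges (x : HalfEdgeMap H Gt ct) : Set.BijOn (Sym2.map ct) x.edges H.edgeSet := by
  refine ⟨?_, ?_, ?_⟩
  · rintro _ ⟨u, v, h, rfl⟩
    simpa [x.2.1] using h
  · rintro m hm m' ⟨u, v, h, rfl⟩ hmm'
    exact x.edges_eq_of_map_eq hm h (by simpa [x.2.1] using hmm')
  · intro e he
    induction e using Sym2.ind with
    | h u v => exact ⟨_, ⟨u, v, he, rfl⟩, by simp [x.2.1]⟩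

theorem edges_subset (x : HalfEdgeMap H Gt ct) : x.edges ⊆ Gt.edgeSet := by
  rintro _ ⟨u, v, h, rfl⟩
  exact x.2.2 u v _ _ _ h.ne

theorem exists_eq_of_mem_edges (x : HalfEdgeMap H Gt ct) {m : Sym2 V} (hm : m ∈ x.edges) {w : V}
    (hw : w ∈ m) : ∃ h : m.map ct ∈ H.incidenceSet (ct w), w = x.1 (ct w) ⟨m.map ct, h⟩ := by
  have hH : m.map ct ∈ H.edgeSet := x.bijOn_edges.mapsTo hm
  refine ⟨⟨hH, Sym2.mem_map.2 ⟨w, hw, rfl⟩⟩, ?_⟩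
  obtain ⟨u, v, h, rfl⟩ := hm
  rcases Sym2.mem_iff.1 hw with rfl | rfl <;>
    exact x.apply_eq_apply (by simp [x.2.1]) (by simp [x.2.1])

theorem mem_edges_of_mem {x : HalfEdgeMap H Gt ct} (v : VH) (e : H.incidenceSet v) :
    ∃ m ∈ x.edges, x.1 v e ∈ m ∧ m.map ct = e.1 := by
  obtain ⟨e, he⟩ := e
  obtain ⟨u, rfl⟩ := Sym2.mem_iff_exists.1 he.2
  exact ⟨_, ⟨v, u, he.1, rfl⟩, by simp, by simp [x.2.1]⟩

theorem edges_injective : Function.Injective (edges : HalfEdgeMap H Gt ct → _) := by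
  intro x y hxy
  ext v e
  obtain ⟨m, hm, hv, hme⟩ := mem_edges_of_mem (x := x) v e
  obtain ⟨h, hy⟩ := y.exists_eq_of_mem_edges (hxy ▸ hm) hv
  exact hy.trans (y.apply_eq_apply (x.2.1 v e) hme)

theorem pairwise_disjoint_edges_iff (x : HalfEdgeMap H Gt ct) :
    x.edges.Pairwise (fun e f => ∀ v : V, ¬(v ∈ e ∧ v ∈ f)) ↔ x.kernel = ⊥ := by
  constructor
  · intro hd
    refine le_bot_iff.1 fun v e e' h => ?_
    obtain ⟨m, hm, hv, hme⟩ := mem_edges_of_mem (x := x) v e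
    obtain ⟨m', hm', hv', hme'⟩ := mem_edges_of_mem (x := x) v e'
    by_contra hne
    refine hd hm hm' (fun hmm => hne (Subtype.ext ?_)) _ ⟨hv, ?_⟩
    · rw [← hme, ← hme', hmm]
    · rwa [show x.1 v e = x.1 v e' from h]
  · rintro hk m hm m' hm' hne w ⟨hw, hw'⟩
    obtain ⟨h, hx⟩ := x.exists_eq_of_mem_edges hm hw
    obtain ⟨h', hx'⟩ := x.exists_eq_of_mem_edges hm' hw'
    have hker : x.kernel (ct w) ⟨_, h⟩ ⟨_, h'⟩ := hx.symm.trans hx'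
    rw [hk] at hker
    exact hne (x.bijOn_edges.injOn hm hm' (congrArg Subtype.val hker))

theorem exists_edges_eq {M : Set (Sym2 V)} (hM : M ⊆ Gt.edgeSet)
    (hb : Set.BijOn (Sym2.map ct) M H.edgeSet) : ∃ x : HalfEdgeMap H Gt ct, x.edges = M := by
  have hex : ∀ (v : VH) (e : H.incidenceSet v), ∃ w, ct w = v ∧ ∃ m ∈ M, w ∈ m ∧
      m.map ct = e.1 := by
    rintro v ⟨e, he, hv⟩
    obtain ⟨m, hm, rfl⟩ := hb.surjOn he
    obtain ⟨w, hw, rfl⟩ := Sym2.mem_map.1 hv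
    exact ⟨w, rfl, m, hm, hw, rfl⟩
  choose x hx m hm hxm hme using hex
  have hmk : ∀ (u v : VH) (e : Sym2 VH) (hu : e ∈ H.incidenceSet u) (hv : e ∈ H.incidenceSet v),
      u ≠ v → m u ⟨e, hu⟩ = s(x u ⟨e, hu⟩, x v ⟨e, hv⟩) := by
    intro u v e hu hv hne
    have hmm : m u ⟨e, hu⟩ = m v ⟨e, hv⟩ :=
      hb.injOn (hm _ _) (hm _ _) ((hme u ⟨e, hu⟩).trans (hme v ⟨e, hv⟩).symm)
    refine (Sym2.mem_and_mem_iff fun h => hne ?_).1 ⟨hxm _ _, hmm ▸ hxm _ _⟩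
    rw [← hx u ⟨e, hu⟩, h, hx]
  refine ⟨⟨x, hx, fun u v e hu hv hne => ?_⟩, Set.Subset.antisymm ?_ fun n hn => ?_⟩
  · rw [← SimpleGraph.mem_edgeSet, ← hmk u v e hu hv hne]
    exact hM (hm _ _)
  · rintro _ ⟨u, v, h, rfl⟩
    rw [← hmk u v _ _ _ h.ne]
    exact hm _ _
  · have hc := hb.mapsTo hn
    obtain ⟨⟨u, v⟩, huv⟩ := Sym2.mk_surjective (n.map ct)
    have huv : s(u, v) = n.map ct := huv
    have h : H.Adj u v := by rwa [← huv] at hc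
    refine ⟨u, v, h, ?_⟩
    rw [← hmk u v _ _ _ h.ne]
    exact hb.injOn hn (hm _ _) (huv.symm.trans (hme u ⟨s(u, v), _⟩).symm)

theorem card_colourfulMatching [Finite V] :
    Nat.card {M : Finset (Sym2 V) // IsColourfulMatching H Gt ct M} =
      Nat.card {x : HalfEdgeMap H Gt ct // x.kernel = ⊥} := by
  symm
  refine Nat.card_eq_of_bijective (fun x => ⟨(Set.toFinite x.1.edges).toFinset, ?_⟩) ⟨?_, ?_⟩
  · rw [IsColourfulMatching, Set.Finite.coe_toFinset]
    exact ⟨x.1.edges_subset, x.1.pairwise_disjoint_edges_iff.2 x.2, x.1.bijOn_edges⟩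
  · intro x y h
    exact Subtype.ext (edges_injective (Set.Finite.toFinset_inj.1 (congrArg Subtype.val h)))
  · rintro ⟨M, hM, hd, hb⟩
    obtain ⟨x, hx⟩ := exists_edges_eq hM hb
    exact ⟨⟨x, x.pairwise_disjoint_edges_iff.1 (hx ▸ hd)⟩, Subtype.ext (by simp [hx])⟩

open Classical in
/-- Summing over homomorphisms from all fractured graphs amounts to summing, over all half-edge
maps, the total coefficient of the fractures below the kernel. -/
theorem sum_mul_card_fracturedHom [Finite V] [Finite VH] [Fintype (HalfEdgeMap H Gt ct)]
    (a : FractureOf H → ℚ) :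
    ∑ ρ, a ρ * (Nat.card {φ : FracturedGraph H ρ →g Gt // ct ∘ φ = fracColor H ρ} : ℚ) =
      ∑ x : HalfEdgeMap H Gt ct, ∑ ρ with ρ ≤ x.kernel, a ρ := by
  simp_rw [Nat.card_congr (fracturedHomEquiv H Gt ct _), Nat.card_eq_fintype_card,
    Fintype.card_subtype, Finset.sum_filter]
  rw [Finset.sum_comm]
  refine Finset.sum_congr rfl fun ρ _ => ?_
  rw [← Finset.sum_filter, Finset.sum_const, nsmul_eq_mul, mul_comm]

/-- The fractured graph `H ⤡ τ` has exactly one edge of each colour. -/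
def toFractured (τ : FractureOf H) : HalfEdgeMap H (FracturedGraph H τ) (fracColor H τ) :=
  ⟨fun v e => ⟨v, Quotient.mk _ e⟩, fun _ _ => rfl,
    fun _ _ e hu hv hne => fracturedGraph_adj_iff.2 ⟨hne, e, hu, hv, rfl, rfl⟩⟩

theorem eq_toFractured {τ : FractureOf H} (x : HalfEdgeMap H (FracturedGraph H τ) (fracColor H τ)) :
    x = toFractured τ := by
  obtain ⟨x, hc, hadj⟩ := x
  refine Subtype.ext (funext fun v => funext fun ⟨e, he⟩ => ?_)
  obtain ⟨u, rfl⟩ := Sym2.mem_iff_exists.1 he.2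
  have h : H.Adj v u := he.1
  have hu : s(v, u) ∈ H.incidenceSet u := H.mk'_mem_incidenceSet_right_iff.2 h
  have hvu := hadj v u _ he hu h.ne
  have hcv := hc v ⟨s(v, u), he⟩
  have hcu := hc u ⟨s(v, u), hu⟩
  change x v ⟨s(v, u), he⟩ = ⟨v, Quotient.mk _ ⟨s(v, u), he⟩⟩
  generalize x v ⟨s(v, u), he⟩ = p at *
  generalize x u ⟨s(v, u), hu⟩ = q at *
  obtain ⟨v', p⟩ := p
  obtain ⟨u', q⟩ := q
  obtain rfl : v' = v := hcv
  obtain rfl : u' = u := hcu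
  obtain ⟨-, e, hp, hq, rfl, rfl⟩ := fracturedGraph_adj_iff.1 hvu
  obtain rfl : e = s(v', u') := (Sym2.mem_and_mem_iff h.ne).1 ⟨hp.2, hq.2⟩
  rfl

theorem kernel_toFractured (τ : FractureOf H) : (toFractured τ).kernel = τ := by
  funext v
  ext e e'
  refine Iff.trans ?_ (Quotient.eq (r := τ v))
  change (⟨v, Quotient.mk _ e⟩ : FracVert H τ) = ⟨v, Quotient.mk _ e'⟩ ↔ _
  constructor
  · intro h
    exact eq_of_heq (Sigma.mk.inj h).2
  · intro h
    rw [h]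

end HalfEdgeMap

open Classical in
theorem matchingIdentity_iff {β : Type} [Fintype β] (H : SimpleGraph β)
    (hiso : ∀ v : β, ∃ u, H.Adj v u) (a : FractureOf H → ℚ) :
    MatchingIdentity H a ↔ ∀ τ, ∑ ρ with ρ ≤ τ, a ρ = if τ = ⊥ then 1 else 0 := by
  have key : ∀ (α : Type) [Fintype α] (Gt : SimpleGraph α) (ct : α → β)
      [Fintype (HalfEdgeMap H Gt ct)],
      (Nat.card {M : Finset (Sym2 α) // IsColourfulMatching H Gt ct M} : ℚ) =
        ∑ x : HalfEdgeMap H Gt ct, if x.kernel = ⊥ then 1 else 0 := by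
    intro α _ Gt ct _
    rw [HalfEdgeMap.card_colourfulMatching, Nat.card_eq_fintype_card, Fintype.card_subtype,
      Finset.sum_boole]
  constructor
  · intro h τ
    have (v : β) : Finite (Quotient (τ v)) := Quotient.finite _
    have : Finite (FracVert H τ) := inferInstanceAs (Finite (Σ v, Quotient (τ v)))
    let := Fintype.ofFinite (FracVert H τ)
    let : Unique (HalfEdgeMap H (FracturedGraph H τ) (fracColor H τ)) :=
      ⟨⟨HalfEdgeMap.toFractured τ⟩, HalfEdgeMap.eq_toFractured⟩
    have hτ := h (FracVert H τ) (FracturedGraph H τ)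
      ⟨fracColor H τ, fun {p q} hpq => by
        obtain ⟨hne, e, hp, hq, -⟩ := fracturedGraph_adj_iff.1 hpq
        obtain rfl : e = s(p.1, q.1) := (Sym2.mem_and_mem_iff hne).1 ⟨hp.2, hq.2⟩
        exact hp.1⟩
      fun v => by
        obtain ⟨u, hu⟩ := hiso v
        exact ⟨⟨v, Quotient.mk _ ⟨s(v, u), H.mk'_mem_incidenceSet_left_iff.2 hu⟩⟩, rfl⟩
    change (Nat.card {M // IsColourfulMatching H _ (fracColor H τ) M} : ℚ) =
      ∑ ρ, a ρ * (Nat.card {φ : FracturedGraph H ρ →g _ // fracColor H τ ∘ φ = _} : ℚ) at hτ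
    rw [key, HalfEdgeMap.sum_mul_card_fracturedHom, Fintype.sum_unique, Fintype.sum_unique,
      show (default : HalfEdgeMap H (FracturedGraph H τ) (fracColor H τ)) =
        HalfEdgeMap.toFractured τ from rfl, HalfEdgeMap.kernel_toFractured] at hτ
    exact hτ.symm
  · intro h α _ Gt ct _
    let := Fintype.ofFinite (HalfEdgeMap H Gt ct)
    rw [key, HalfEdgeMap.sum_mul_card_fracturedHom]
    exact Finset.sum_congr rfl fun x _ => (h _).symm

/-- For a graph `H` without isolated vertices there is a unique
function `a` from the fractures of `H` to `ℚ` such that, for every surjectively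
`H`-coloured graph, the number of colourful matchings equals
`∑_ρ a(ρ) · #Hom((H⤡ρ, c_ρ) → (G̃, c̃))`; moreover every such function satisfies
`a(⊤) = ∏_v (-1)^(deg v - 1) · (deg v - 1)!` for the coarsest fracture `⊤`. -/
theorem stmt_15 {β : Type} [Fintype β] [DecidableEq β] (H : SimpleGraph β)
    [DecidableRel H.Adj] (hiso : ∀ v : β, 0 < H.degree v) :
    (∃! a : FractureOf H → ℚ, MatchingIdentity H a) ∧
    ∀ a : FractureOf H → ℚ, MatchingIdentity H a →
      a (fun _ => ⊤)
        = ∏ v : β, (-1 : ℚ) ^ (H.degree v - 1) * (Nat.factorial (H.degree v - 1) : ℚ) := by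
  let : Fintype (∀ v, Setoid (H.incidenceSet v)) := fractureFintype H
  have hadj : ∀ v, ∃ u, H.Adj v u := fun v => (H.degree_pos_iff_exists_adj v).1 (hiso v)
  have hmoebius (τ : FractureOf H) := sum_prod_partitionMoebius_le
    (E := fun v => H.incidenceSet v) τ (hdec := fractureDecEq H τ ⊥)
  have hex : MatchingIdentity H fun ρ => ∏ v, partitionMoebius (ρ v) :=
    (matchingIdentity_iff H hadj _).2 hmoebius
  have huniq : ∀ a, MatchingIdentity H a → a = fun ρ => ∏ v, partitionMoebius (ρ v) := by
    classical
    exact fun a ha => eq_of_sum_le_eq fun τ =>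
      ((matchingIdentity_iff H hadj a).1 ha τ).trans (hmoebius τ).symm
  refine ⟨⟨_, hex, huniq⟩, fun a ha => ?_⟩
  rw [huniq a ha]
  refine Finset.prod_congr rfl fun v _ => ?_
  obtain ⟨u, hu⟩ := hadj v
  have : Nonempty (H.incidenceSet v) := ⟨⟨s(v, u), H.mk'_mem_incidenceSet_left_iff.2 hu⟩⟩
  rw [partitionMoebius_top, H.card_incidenceSet_eq_degree]

end Fmz
end
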